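/- arXiv:1912.06241 — 2 statements merged into one kernel-verified Lean document; each statement's English description precedes it below -/
import Mathlib

section
/- Let N ≥ 3 and n = N−1. There exists a nonzero polynomial p in n+1 complex variables such that for every (ω_1,…,ω_n, a) ∈ ℂ^n × ℂ with p(ω_1,…,ω_n, a) ≠ 0, the set of solutions x ∈ (ℂ∖{0})^n of the algebraic Kuramoto system for the cycle C_N with uniform coupling is finite, and its cardinality equals N·binom(N−1, ⌊(N−1)/2⌋) if N is not divisible by 4, and equals (N−2)·binom(N−1, N/2−1) if N is divisible by 4. -/
open Complex

noncomputable section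

/-- Extended variables for the cycle `C_N`: `X 0 = 1` (the reference oscillator),
`X j = x_j` for `j = 1, …, N-1`, with indices taken modulo `N`. -/
def kuraX (N : ℕ) (hN : 0 < N) (x : Fin (N - 1) → ℂ) : ℕ → ℂ := fun j =>
  if hr : j % N = 0 then 1
  else x ⟨j % N - 1, Nat.sub_lt_sub_right (Nat.pos_of_ne_zero hr) (Nat.mod_lt j hN)⟩

/-- The `i`-th equation of the algebraic Kuramoto system for the cycle `C_N`
with uniform coupling: `f_i(x) = ω_i − a (x_i/x_{i-1} − x_{i-1}/x_i + x_i/x_{i+1} − x_{i+1}/x_i)`,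
where `i : Fin (N-1)` represents node `i+1 ∈ {1, …, N-1}`. -/
def kuraF (N : ℕ) (hN : 0 < N) (ω : Fin (N - 1) → ℂ) (a : ℂ) (i : Fin (N - 1))
    (x : Fin (N - 1) → ℂ) : ℂ :=
  ω i - a * (kuraX N hN x (i.val + 1) / kuraX N hN x i.val
    - kuraX N hN x i.val / kuraX N hN x (i.val + 1)
    + kuraX N hN x (i.val + 1) / kuraX N hN x (i.val + 2)
    - kuraX N hN x (i.val + 2) / kuraX N hN x (i.val + 1))

open Polynomial in
theorem exists_eval_mul_conj (b f₀ : ℂ[X]) (f : ℂ[X][X]) :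
    ∃ g : ℂ[X][X], ∀ z Y m : ℂ, Y ^ 2 = b.eval z * Y + f₀.eval z →
      g.evalEval z m = f.evalEval z (Y * m) * f.evalEval z ((b.eval z - Y) * m) := by
  set q : ℂ[X][X][X] := X ^ 2 - C (C b) * X - C (C f₀) with hq
  have hqm : q.Monic := by
    rw [hq]; monicity!
  have hqd : q.natDegree = 2 := by
    rw [hq]; compute_degree!
  set F : ℂ[X][X][X] := (f.map C).comp (C X * X) with hF
  set r := F %ₘ q with hr
  have hrd : r.natDegree < 2 := by
    rw [← hqd]
    exact natDegree_modByMonic_lt _ hqm (by intro h; rw [h] at hqd; simp at hqd)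
  set α := r.coeff 0
  set β := r.coeff 1
  have hrab : r = C β * X + C α := Polynomial.eq_X_add_C_of_natDegree_le_one (by omega)
  refine ⟨α ^ 2 + α * β * C b - C f₀ * β ^ 2, fun z Y m hY => ?_⟩
  have key : ∀ y : ℂ, y ^ 2 = b.eval z * y + f₀.eval z →
      f.evalEval z (y * m) = α.evalEval z m + β.evalEval z m * y := by
    intro y hy
    let φ : ℂ[X][X] →+* ℂ := evalEvalRingHom z m
    have h1 : f.evalEval z (y * m) = F.eval₂ φ y := by
      rw [hF, eval₂_comp, eval₂_map]
      simp only [eval₂_mul, eval₂_C, eval₂_X]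
      have h3 : φ.comp C = evalRingHom z := by ext <;> simp [φ]
      rw [h3, eval₂_evalRingHom]
      simp [φ, mul_comm]
    have h2 : F.eval₂ φ y = r.eval₂ φ y := by
      conv_lhs => rw [← modByMonic_add_div F q]
      rw [eval₂_add, eval₂_mul]
      have : q.eval₂ φ y = 0 := by
        simp [hq, φ, hy]
      rw [this, zero_mul, add_zero]
    rw [h1, h2, hrab]
    simp [φ]
    ring
  rw [key Y hY, key (b.eval z - Y) (by linear_combination hY)]
  simp [evalEval_sub, evalEval_add, evalEval_mul, evalEval_pow, evalEval_C]
  linear_combination ((β.evalEval z m)^2) * hY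

theorem exists_dvd_aeval {σ : Type} [Fintype σ] (c : σ → MvPolynomial σ ℂ)
    {h : MvPolynomial σ ℂ} (hh : h ≠ 0) :
    ∃ P : MvPolynomial σ ℂ, P ≠ 0 ∧ h ∣ MvPolynomial.aeval c P := by
  by_cases hc : AlgebraicIndependent ℂ c
  · have htb : IsTranscendenceBasis ℂ c :=
      AlgebraicIndependent.isTranscendenceBasis_of_trdeg_le_of_finite hc (by simp)
    have := htb.isAlgebraic
    obtain ⟨a, ha, hd⟩ := (this.isAlgebraic h).exists_nonzero_dvd (by simpa using hh)
    obtain ⟨P, hP⟩ : ∃ P : MvPolynomial σ ℂ, MvPolynomial.aeval c P = a := by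
      have h₁ := a.2
      have h₂ := Algebra.adjoin_range_eq_range_aeval ℂ c
      exact (h₂.le h₁ :)
    refine ⟨P, ?_, ?_⟩
    · rintro rfl
      apply ha
      ext1
      rw [← hP]; simp
    · rw [hP]; exact hd
  · rw [algebraicIndependent_iff] at hc
    push Not at hc
    obtain ⟨P, hP, h0⟩ := hc
    exact ⟨P, h0, by rw [hP]; exact dvd_zero h⟩

open Polynomial in
theorem exists_eval_eq_prod_powerset {ι : Type} [DecidableEq ι] (b : ι → ℂ[X]) (d : ℂ[X])
    (s : Finset ι) (f : ℂ[X][X]) :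
    ∃ g : ℂ[X], ∀ (z : ℂ) (Y : ι → ℂ),
      (∀ i ∈ s, Y i ^ 2 = (b i).eval z * Y i + d.eval z) →
      g.eval z = ∏ A ∈ s.powerset,
        f.evalEval z (∏ i ∈ s, if i ∈ A then Y i else (b i).eval z - Y i) := by
  induction s using Finset.induction_on generalizing f with
  | empty => exact ⟨f.eval 1, fun z Y _ => by simp [evalEval]⟩
  | insert i s hi ih =>
    obtain ⟨f₂, hf₂⟩ := exists_eval_mul_conj (b i) d f
    obtain ⟨g, hg⟩ := ih f₂
    refine ⟨g, fun z Y hY => ?_⟩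
    rw [hg z Y fun j hj => hY j (Finset.mem_insert_of_mem hj), Finset.prod_powerset_insert hi,
      ← Finset.prod_mul_distrib]
    refine Finset.prod_congr rfl fun A hA => ?_
    have hiA : i ∉ A := fun h => hi (Finset.mem_powerset.1 hA h)
    rw [hf₂ z (Y i) _ (hY i (Finset.mem_insert_self i s)), mul_comm, Finset.prod_insert hi,
      Finset.prod_insert hi, if_neg hiA, if_pos (Finset.mem_insert_self i A)]
    congr 3
    refine Finset.prod_congr rfl fun j hj => ?_
    have : j ≠ i := fun h => hi (h ▸ hj)
    simp [this]

/-- The product of the `y i`, with `y i` replaced by `-1 / y i` for `i` outside `A`. -/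
def flipProd {ι : Type} [Fintype ι] [DecidableEq ι] (A : Finset ι) (y : ι → ℂ) : ℂ :=
  ∏ i, if i ∈ A then y i else -(y i)⁻¹

/-- `y` lies over `z` when `y i - 1 / y i = z - 1 / z + c i` for all `i`. -/
def LiesOver {ι : Type} (c : ι → ℂ) (z : ℂ) (y : ι → ℂ) : Prop :=
  ∀ i, y i ≠ 0 ∧ y i - (y i)⁻¹ = z - z⁻¹ + c i

open Polynomial in
theorem exists_eliminant {ι : Type} [Fintype ι] [DecidableEq ι] (c : ι → ℂ)
    (hι : 1 ≤ Fintype.card ι) :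
    ∃ p : ℂ[X], ∀ z ≠ 0, ∀ y, LiesOver c z y →
      p.eval z = z ^ ((Fintype.card ι - 1) * 2 ^ Fintype.card ι) *
        ∏ A : Finset ι, (1 - z * flipProd A y) := by
  obtain ⟨g, hg⟩ := exists_eval_eq_prod_powerset (fun i => X ^ 2 + C (c i) * X - 1) (X ^ 2)
    (Finset.univ : Finset ι) (C (X ^ (Fintype.card ι - 1)) - X)
  refine ⟨g, fun z hz y hy => ?_⟩
  rw [hg z (fun i => z * y i), Finset.powerset_univ, pow_mul, ← Fintype.card_finset,
    ← Finset.card_univ (α := Finset ι), ← Finset.prod_const, ← Finset.prod_mul_distrib]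
  · refine Finset.prod_congr rfl fun A _ => ?_
    have : ∏ i, (if i ∈ A then z * y i else
        ((X ^ 2 + C (c i) * X - 1 : ℂ[X]).eval z - z * y i)) =
        z ^ Fintype.card ι * flipProd A y := by
      rw [flipProd, ← Finset.card_univ, ← Finset.prod_const, ← Finset.prod_mul_distrib]
      refine Finset.prod_congr rfl fun i _ => ?_
      split_ifs
      · rfl
      · obtain ⟨h0, h⟩ := hy i
        simp only [eval_add, eval_sub, eval_mul, eval_pow, eval_X, eval_C, eval_one]
        field_simp at h ⊢
        linear_combination (-1) * h
    rw [this]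
    simp only [evalEval_sub, evalEval_C, evalEval_X, eval_pow, eval_X]
    obtain ⟨k, hk⟩ := Nat.exists_eq_add_of_le hι
    rw [hk]
    simp only [Nat.add_sub_cancel_left]
    ring
  · intro i _
    obtain ⟨h0, h⟩ := hy i
    simp only [eval_add, eval_sub, eval_mul, eval_pow, eval_X, eval_C, eval_one]
    field_simp at h
    linear_combination z * h

open Filter Topology Bornology

/-- `a` has the expansion `1 + α / w + o(1 / w)` at infinity. -/
def HasExpansion (a : ℂ → ℂ) (α : ℂ) : Prop :=
  Tendsto (fun w => w * (a w - 1)) (cobounded ℂ) (𝓝 α)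

theorem HasExpansion.tendsto_one {a : ℂ → ℂ} {α : ℂ} (ha : HasExpansion a α) :
    Tendsto a (cobounded ℂ) (𝓝 1) := by
  have h : Tendsto (fun w => w⁻¹ * (w * (a w - 1)) + 1) (cobounded ℂ) (𝓝 (0 * α + 1)) :=
    (tendsto_inv₀_cobounded.mul ha).add_const 1
  rw [zero_mul, zero_add] at h
  refine h.congr' ?_
  filter_upwards [eventually_ne_cobounded 0] with w hw
  field_simp
  ring

theorem HasExpansion.one : HasExpansion (fun _ => 1) 0 := by
  simp [HasExpansion]

theorem HasExpansion.mul {a b : ℂ → ℂ} {α β : ℂ} (ha : HasExpansion a α)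
    (hb : HasExpansion b β) : HasExpansion (fun w => a w * b w) (α + β) := by
  have h : Tendsto (fun w => w * (a w - 1) * b w + w * (b w - 1)) (cobounded ℂ)
      (𝓝 (α * 1 + β)) := (Tendsto.mul ha hb.tendsto_one).add hb
  rw [mul_one] at h
  exact h.congr fun w => by ring

theorem HasExpansion.inv {a : ℂ → ℂ} {α : ℂ} (ha : HasExpansion a α) :
    HasExpansion (fun w => (a w)⁻¹) (-α) := by
  have h : Tendsto (fun w => -(w * (a w - 1)) * (a w)⁻¹) (cobounded ℂ) (𝓝 (-α * 1⁻¹)) :=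
    (Tendsto.neg ha).mul (ha.tendsto_one.inv₀ one_ne_zero)
  rw [inv_one, mul_one] at h
  refine h.congr' ?_
  filter_upwards [ha.tendsto_one.eventually_ne one_ne_zero] with w hw
  field_simp
  ring

theorem HasExpansion.prod {ι : Type} (s : Finset ι) {a : ι → ℂ → ℂ} {α : ι → ℂ}
    (h : ∀ i ∈ s, HasExpansion (a i) (α i)) :
    HasExpansion (fun w => ∏ i ∈ s, a i w) (∑ i ∈ s, α i) := by
  classical
  induction s using Finset.induction_on with
  | empty => simpa using HasExpansion.one
  | insert i s hi ih =>
    simp only [Finset.prod_insert hi, Finset.sum_insert hi]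
    exact (h i (Finset.mem_insert_self i s)).mul
      (ih fun j hj => h j (Finset.mem_insert_of_mem hj))

theorem exists_sub_inv_eq (t : ℂ) : ∃ y : ℂ, 1 ≤ ‖y‖ ∧ y - y⁻¹ = t := by
  obtain ⟨r, hr⟩ := IsAlgClosed.exists_pow_nat_eq (t ^ 2 + 4) (n := 2) (by norm_num)
  have hq : ((t + r) / 2) ^ 2 = t * ((t + r) / 2) + 1 := by linear_combination hr / 4
  set y := (t + r) / 2
  have hy : y ≠ 0 := by
    intro h
    simp [h] at hq
  have hy' : y - y⁻¹ = t := by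
    field_simp
    linear_combination hq
  rcases le_total 1 ‖y‖ with h | h
  · exact ⟨y, h, hy'⟩
  · refine ⟨-y⁻¹, ?_, ?_⟩
    · rw [norm_neg, norm_inv]
      exact (one_le_inv₀ (norm_pos_iff.2 hy)).2 h
    · rw [inv_neg, inv_inv, ← hy']
      ring

theorem exists_large_branch (c : ℂ) :
    ∃ u : ℂ → ℂ, (∀ w, u w ≠ 0 ∧ u w - (u w)⁻¹ = w - w⁻¹ + c) ∧
      HasExpansion (fun w => u w / w) c := by
  choose u hu1 hu using fun w : ℂ => exists_sub_inv_eq (w - w⁻¹ + c)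
  have hu0 : ∀ w, u w ≠ 0 := fun w h => by
    have := hu1 w
    rw [h, norm_zero] at this
    linarith
  refine ⟨u, fun w => ⟨hu0 w, hu w⟩, ?_⟩
  have hlim : Tendsto u (cobounded ℂ) (cobounded ℂ) := by
    rw [← tendsto_norm_atTop_iff_cobounded]
    have h1 : Tendsto (fun w : ℂ => ‖w‖ + -(‖c‖ + 2)) (cobounded ℂ) atTop :=
      tendsto_atTop_add_const_right _ _ tendsto_norm_cobounded_atTop
    refine tendsto_atTop_mono' _ ?_ h1
    filter_upwards [tendsto_norm_cobounded_atTop.eventually_ge_atTop 1] with w hw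
    have e : w = u w - (u w)⁻¹ + w⁻¹ - c := by rw [hu w]; ring
    have a1 : ‖(u w)⁻¹‖ ≤ 1 := by rw [norm_inv]; exact inv_le_one_of_one_le₀ (hu1 w)
    have a2 : ‖w⁻¹‖ ≤ 1 := by rw [norm_inv]; exact inv_le_one_of_one_le₀ hw
    have := norm_sub_le (u w - (u w)⁻¹ + w⁻¹) c
    have := norm_add_le (u w - (u w)⁻¹) w⁻¹
    have := norm_sub_le (u w) (u w)⁻¹
    rw [← e] at *
    linarith
  have h : Tendsto (fun w => c - w⁻¹ + (u w)⁻¹) (cobounded ℂ) (𝓝 (c - 0 + 0)) :=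
    (tendsto_const_nhds.sub tendsto_inv₀_cobounded).add (tendsto_inv₀_cobounded.comp hlim)
  rw [sub_zero, add_zero] at h
  refine h.congr' ?_
  filter_upwards [eventually_ne_cobounded 0] with w hw
  have := hu w
  rw [mul_sub, mul_div_cancel₀ _ hw]
  linear_combination (-1) * this

theorem tendsto_zpow_cobounded {k : ℤ} (hk : k < 0) :
    Tendsto (fun w : ℂ => w ^ k) (cobounded ℂ) (𝓝 0) := by
  obtain ⟨m, rfl⟩ : ∃ m : ℕ, k = -((m + 1 : ℕ) : ℤ) := ⟨(-k - 1).toNat, by omega⟩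
  have h : Tendsto (fun w : ℂ => w⁻¹ ^ (m + 1)) (cobounded ℂ) (𝓝 (0 ^ (m + 1))) :=
    tendsto_inv₀_cobounded.pow _
  rw [zero_pow (by omega)] at h
  exact h.congr fun w => by rw [zpow_neg, zpow_natCast, inv_pow]

theorem HasExpansion.exists_tendsto {R : ℂ → ℂ} {L s : ℂ} (hR : HasExpansion R L) (e : ℤ)
    (hs : s ≠ 0) (hL : e = 0 → s = 1 → L ≠ 0) {κ : ℤ} (h1 : 0 < e → κ = e)
    (h2 : e = 0 → s = 1 → κ = -1) (h3 : e = 0 → s ≠ 1 → κ = 0) (h4 : e < 0 → κ = 0) :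
    ∃ l ≠ 0, Tendsto (fun w => (1 - s * w ^ e * R w) * w ^ (-κ)) (cobounded ℂ) (𝓝 l) := by
  rcases lt_trichotomy e 0 with he | he | he
  · refine ⟨1, one_ne_zero, ?_⟩
    rw [h4 he]
    have : Tendsto (fun w => 1 - s * w ^ e * R w) (cobounded ℂ) (𝓝 (1 - s * 0 * 1)) :=
      (((tendsto_zpow_cobounded he).const_mul s).mul hR.tendsto_one).const_sub 1
    simpa using this
  · by_cases hs1 : s = 1
    · refine ⟨-L, neg_ne_zero.2 (hL he hs1), ?_⟩
      rw [h2 he hs1, he, hs1]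
      exact (Tendsto.neg hR).congr fun w => by simp; ring
    · refine ⟨1 - s, sub_ne_zero.2 (Ne.symm hs1), ?_⟩
      rw [h3 he hs1, he]
      simpa using (hR.tendsto_one.const_mul s).const_sub 1
  · refine ⟨-s, neg_ne_zero.2 hs, ?_⟩
    rw [h1 he]
    have : Tendsto (fun w => w ^ (-e) - s * R w) (cobounded ℂ) (𝓝 (0 - s * 1)) :=
      (tendsto_zpow_cobounded (by omega)).sub (hR.tendsto_one.const_mul s)
    rw [mul_one, zero_sub] at this
    refine this.congr' ?_
    filter_upwards [eventually_ne_cobounded 0] with w hw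
    have : w ^ e * w ^ (-e) = 1 := by rw [← zpow_add₀ hw]; simp
    linear_combination s * R w * this

/-- The growth exponent at infinity of a factor `1 ± w ^ e * (1 + O(1 / w))` of the eliminant. -/
def growth (n : ℕ) (e : ℤ) : ℤ := if 0 < e then e else if e = 0 ∧ 4 ∣ n + 1 then -1 else 0

theorem exists_tendsto_prod {ι : Type} [Fintype ι] [DecidableEq ι] (c : ι → ℂ)
    (hc : ∀ A : Finset ι, (∑ i, if i ∈ A then c i else -c i) ≠ 0) :
    ∃ u : ℂ → ι → ℂ, (∀ w, LiesOver c w (u w)) ∧ ∀ δ : ℤ, δ = 1 ∨ δ = -1 →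
      ∃ l ≠ 0, Tendsto (fun w => (∏ A, (1 - δ * w ^ δ * flipProd A (u w))) *
        w ^ (-∑ A : Finset ι, growth (Fintype.card ι) (2 * A.card - Fintype.card ι + δ)))
        (cobounded ℂ) (𝓝 l) := by
  choose u hu hexp using fun i => exists_large_branch (c i)
  refine ⟨fun w i => u i w, fun w i => hu i w, fun δ hδ => ?_⟩
  have key : ∀ A : Finset ι, ∃ l : ℂ, l ≠ 0 ∧
      Tendsto (fun w => (1 - δ * w ^ δ * flipProd A (fun i => u i w)) *
        w ^ (-growth (Fintype.card ι) (2 * A.card - Fintype.card ι + δ))) (cobounded ℂ) (𝓝 l) := by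
    intro A
    have hcard : A.card ≤ Fintype.card ι := Finset.card_le_univ A
    have hR : HasExpansion (fun w => ∏ i, if i ∈ A then u i w / w else (u i w / w)⁻¹)
        (∑ i, if i ∈ A then c i else -c i) := by
      refine HasExpansion.prod _ fun i _ => ?_
      split_ifs
      exacts [hexp i, (hexp i).inv]
    have hflip : ∀ w ≠ 0, flipProd A (fun i => u i w) =
        (-1) ^ (Fintype.card ι - A.card) * w ^ (2 * A.card - Fintype.card ι : ℤ) *
          ∏ i, if i ∈ A then u i w / w else (u i w / w)⁻¹ := by
      intro w hw
      have : ((-1) ^ (Fintype.card ι - A.card) * w ^ (2 * A.card - Fintype.card ι : ℤ) : ℂ) =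
          ∏ i : ι, if i ∈ A then w else -w⁻¹ := by
        have hA : (Finset.univ.filter fun i => i ∈ A) = A := by ext; simp
        have hA' : (Finset.univ.filter fun i => i ∉ A) = Aᶜ := by ext; simp
        rw [Finset.prod_ite, Finset.prod_const, Finset.prod_const, hA, hA', Finset.card_compl]
        obtain ⟨m, hm⟩ := Nat.exists_eq_add_of_le hcard
        rw [hm, Nat.add_sub_cancel_left, neg_pow w⁻¹, inv_pow, mul_left_comm]
        congr 1
        have : (2 * A.card - (A.card + m : ℕ) : ℤ) = A.card - m := by push_cast; ring
        rw [this, zpow_sub₀ hw, zpow_natCast, zpow_natCast, div_eq_mul_inv]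
      rw [this, flipProd, ← Finset.prod_mul_distrib]
      refine Finset.prod_congr rfl fun i _ => ?_
      have := (hu i w).1
      split_ifs <;> field_simp
    have hsign : (2 * A.card - Fintype.card ι + δ : ℤ) = 0 →
        ((δ : ℂ) * (-1) ^ (Fintype.card ι - A.card) = 1 ↔ 4 ∣ Fintype.card ι + 1) := by
      intro h
      have hne : (-1 : ℂ) ≠ 1 := by norm_num
      rcases Nat.even_or_odd (Fintype.card ι - A.card) with he | ho <;>
        rcases hδ with rfl | rfl
      · obtain ⟨r, hr⟩ := he
        simp [hr, ← two_mul]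
        omega
      · obtain ⟨r, hr⟩ := he
        simp [hr, ← two_mul, hne]
        omega
      · rw [ho.neg_one_pow]
        obtain ⟨r, hr⟩ := ho
        simp [hne]
        omega
      · rw [ho.neg_one_pow]
        obtain ⟨r, hr⟩ := ho
        simp
        omega
    obtain ⟨l, hl, ht⟩ := hR.exists_tendsto (2 * A.card - Fintype.card ι + δ)
      (s := δ * (-1) ^ (Fintype.card ι - A.card))
      (κ := growth (Fintype.card ι) (2 * A.card - Fintype.card ι + δ))
      (by rcases hδ with rfl | rfl <;> simp) (fun _ _ => hc A)
      (fun h => by simp [growth, h])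
      (fun h hs => by rw [growth, if_neg (by omega), if_pos ⟨h, (hsign h).1 hs⟩])
      (fun h hs => by rw [growth, if_neg (by omega), if_neg fun h' => hs ((hsign h).2 h'.2)])
      (fun h => by
        simp [growth, h.ne, not_lt.2 h.le])
    refine ⟨l, hl, ht.congr' ?_⟩
    filter_upwards [eventually_ne_cobounded 0] with w hw
    rw [hflip w hw, zpow_add₀ hw]
    ring
  choose l hl ht using key
  refine ⟨∏ A, l A, Finset.prod_ne_zero_iff.2 fun A _ => hl A, ?_⟩
  refine (tendsto_finsetProd Finset.univ fun A _ => ht A).congr' ?_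
  filter_upwards [eventually_ne_cobounded 0] with w hw
  rw [Finset.prod_mul_distrib, ← Finset.sum_neg_distrib]
  congr 1
  induction (Finset.univ : Finset (Finset ι)) using Finset.induction_on with
  | empty => simp
  | insert A s hA ih => rw [Finset.prod_insert hA, Finset.sum_insert hA, zpow_add₀ hw, ih]

theorem eq_of_tendsto_mul_zpow {f : ℂ → ℂ} {d e : ℤ} {l m : ℂ} (hl : l ≠ 0) (hm : m ≠ 0)
    (hd : Tendsto (fun w => f w * w ^ (-d)) (cobounded ℂ) (𝓝 l))
    (he : Tendsto (fun w => f w * w ^ (-e)) (cobounded ℂ) (𝓝 m)) : d = e := by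
  wlog hde : d ≤ e generalizing d e l m
  · exact (this hm hl he hd (by omega)).symm
  by_contra hne
  have h0 : Tendsto (fun w : ℂ => w ^ (d - e)) (cobounded ℂ) (𝓝 0) :=
      tendsto_zpow_cobounded (by omega)
  have h1 := hd.mul h0
  rw [mul_zero] at h1
  refine hm (tendsto_nhds_unique (he.congr' ?_) h1)
  filter_upwards [eventually_ne_cobounded 0] with w hw
  rw [mul_assoc, ← zpow_add₀ hw]
  ring_nf

open Polynomial in
theorem tendsto_eval_mul_zpow_natDegree (p : ℂ[X]) :
    Tendsto (fun w => p.eval w * w ^ (-(p.natDegree : ℤ))) (cobounded ℂ)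
      (𝓝 p.leadingCoeff) := by
  have h : Tendsto (fun w => p.reverse.eval w⁻¹) (cobounded ℂ) (𝓝 (p.reverse.eval 0)) :=
    (p.reverse.continuous.tendsto 0).comp tendsto_inv₀_cobounded
  rw [← coeff_zero_eq_eval_zero, coeff_zero_reverse] at h
  refine h.congr' ?_
  filter_upwards [eventually_ne_cobounded 0] with w hw
  let := invertibleOfNonzero hw
  have := eval₂_reverse_mul_pow (RingHom.id ℂ) w p
  rw [invOf_eq_inv] at this
  rw [eval, eval, ← this, mul_assoc, zpow_neg, zpow_natCast,
    mul_inv_cancel₀ (pow_ne_zero _ hw), mul_one]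

open Polynomial in
theorem tendsto_eval_neg_inv_mul_zpow (p : ℂ[X]) (hp : p ≠ 0) :
    ∃ l ≠ 0, Tendsto (fun w => p.eval (-w⁻¹) * w ^ (p.rootMultiplicity 0 : ℤ)) (cobounded ℂ)
      (𝓝 l) := by
  obtain ⟨q, hq, hq0⟩ := exists_eq_pow_rootMultiplicity_mul_and_not_dvd p hp 0
  generalize p.rootMultiplicity 0 = r at hq ⊢
  rw [dvd_iff_isRoot, IsRoot.def] at hq0
  have hlim : Tendsto (fun w : ℂ => -w⁻¹) (cobounded ℂ) (𝓝 0) := by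
    simpa using (tendsto_inv₀_cobounded (α := ℂ)).neg
  refine ⟨(-1) ^ r * q.eval 0, by simpa using hq0, ?_⟩
  have h := ((q.continuous.tendsto 0).comp hlim).const_mul ((-1) ^ r)
  refine h.congr' ?_
  filter_upwards [eventually_ne_cobounded 0] with w hw
  rw [hq]
  simp only [Function.comp, eval_mul, eval_pow, eval_X, C_0, sub_zero, zpow_natCast]
  rw [neg_pow w⁻¹, inv_pow]
  field_simp

theorem sum_growth (n : ℕ) (hn : 1 ≤ n) :
    ∑ k ∈ Finset.range (n + 1), (n.choose k : ℤ) *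
      (growth n (2 * k - n + 1) + growth n (2 * k - n + (-1))) =
    ((if 4 ∣ n + 1 then (n + 1 - 2) * n.choose ((n + 1) / 2 - 1)
      else (n + 1) * n.choose (n / 2) : ℕ) : ℤ) := by
  set m := n / 2 with hm
  have hlow : ∀ k : ℕ, k < m → growth n (2 * k - n + 1) = 0 ∧ growth n (2 * k - n + (-1)) = 0 := by
    intro k hk
    constructor <;> (rw [growth, if_neg (by omega), if_neg (by omega)])
  have hhigh : ∀ k : ℕ, m + 1 < k →
      growth n (2 * k - n + 1) + growth n (2 * k - n + (-1)) = 2 * (2 * k - n) := by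
    intro k hk
    rw [growth, growth, if_pos (by omega), if_pos (by omega)]
    ring
  have hstep : ∀ k ≤ n, ((n.choose (k + 1) : ℤ) * (k + 1)) = n.choose k * (n - k) := by
    intro k hk
    have := Nat.choose_succ_right_eq n k
    zify [hk] at this
    exact this
  have hsum0 : ∑ k ∈ Finset.range m, (n.choose k : ℤ) *
      (growth n (2 * k - n + 1) + growth n (2 * k - n + (-1))) = 0 := by
    refine Finset.sum_eq_zero fun k hk => ?_
    obtain ⟨h1, h2⟩ := hlow k (Finset.mem_range.1 hk)
    rw [h1, h2]; ring
  have htail : ∀ j : ℕ, m + 2 + j ≤ n + 1 → ∑ k ∈ Finset.range (m + 2 + j), (n.choose k : ℤ) *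
      (growth n (2 * k - n + 1) + growth n (2 * k - n + (-1))) =
      ∑ k ∈ Finset.range (m + 2), (n.choose k : ℤ) *
      (growth n (2 * k - n + 1) + growth n (2 * k - n + (-1))) +
      2 * ((m + 2) * n.choose (m + 2) - (m + 2 + j) * n.choose (m + 2 + j)) := by
    intro j
    induction j with
    | zero => intro _; simp
    | succ j ih =>
      intro hj
      rw [← add_assoc, Finset.sum_range_succ, ih (by omega), hhigh _ (by omega)]
      have := hstep (m + 2 + j) (by omega)
      push_cast at this ⊢
      linear_combination 2 * this
  have h1 := htail (n + 1 - (m + 2)) (by omega)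
  have e1 : m + 2 + (n + 1 - (m + 2)) = n + 1 := by omega
  rw [e1] at h1
  have e2 : ((m : ℤ) + 2 + ((n + 1 - (m + 2) : ℕ) : ℤ)) = n + 1 := by omega
  rw [e2, Nat.choose_eq_zero_of_lt (Nat.lt_succ_self n)] at h1
  rw [h1, Finset.sum_range_succ, Finset.sum_range_succ, hsum0]
  have s1 := hstep m (by omega)
  have s2 := hstep (m + 1) (by omega)
  push_cast at s1 s2 ⊢
  rcases Nat.even_or_odd' n with ⟨r, hr | hr⟩
  · have hmr : m = r := by omega
    rw [if_neg (by omega)]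
    rw [growth, if_pos (by omega), growth, if_neg (by omega), if_neg (by omega), growth,
      if_pos (by omega), growth, if_pos (by omega)]
    have hn2 : (n : ℤ) = 2 * m := by omega
    rw [hn2] at s1 s2 ⊢
    linear_combination 2 * s2 + 2 * s1
  · have hmr : m = r := by omega
    have hn2 : (n : ℤ) = 2 * m + 1 := by omega
    have hcc : (n.choose (m + 1) : ℤ) = n.choose m := by
      have h3 : ((m : ℤ) + 1) ≠ 0 := by positivity
      apply mul_right_cancel₀ h3
      rw [s1, hn2]; ring
    by_cases h4 : 4 ∣ n + 1
    · rw [if_pos h4]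
      rw [growth, if_neg (by omega), if_pos (by omega), growth, if_neg (by omega),
        if_neg (by omega), growth,
        if_pos (by omega), growth, if_neg (by omega), if_pos (by omega)]
      have e3 : (n + 1) / 2 - 1 = m := by omega
      have e4' : ((n - 1 : ℕ) : ℤ) = 2 * m := by omega
      rw [e3]
      push_cast [e4']
      rw [hn2] at s1 s2 ⊢
      linear_combination 2 * s2 + (2 * m + 1) * hcc
    · rw [if_neg h4]
      rw [growth, if_neg (by omega), if_neg (by omega), growth, if_neg (by omega),
        if_neg (by omega), growth,
        if_pos (by omega), growth, if_neg (by omega), if_neg (by omega)]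
      push_cast
      rw [hn2] at s1 s2 ⊢
      linear_combination 2 * s2 + (2 * m + 2) * hcc

theorem exists_hasDerivAt_branch (c : ℂ) {z y : ℂ} (hz : z ≠ 0) (hy : y ≠ 0)
    (h : y - y⁻¹ = z - z⁻¹ + c) (hs : 1 + (y ^ 2)⁻¹ ≠ 0) :
    ∃ v : ℂ → ℂ, v z = y ∧ HasDerivAt v ((1 + (y ^ 2)⁻¹)⁻¹ * (1 + (z ^ 2)⁻¹)) z ∧
      ∀ᶠ w in 𝓝 z, v w - (v w)⁻¹ = w - w⁻¹ + c := by
  have hg : ∀ x : ℂ, x ≠ 0 → HasStrictDerivAt (fun x : ℂ => x - x⁻¹) (1 + (x ^ 2)⁻¹) x := by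
    intro x hx
    have := (hasStrictDerivAt_id x).fun_sub (hasStrictDerivAt_inv hx)
    rw [sub_neg_eq_add] at this
    exact this
  have hinv := (hg y hy).to_localInverse hs
  have himg := (hg y hy).hasStrictFDerivAt_equiv hs |>.localInverse_apply_image
  have hright := (hg y hy).hasStrictFDerivAt_equiv hs |>.eventually_right_inverse
  have hin : HasDerivAt (fun w : ℂ => w - w⁻¹ + c) (1 + (z ^ 2)⁻¹) z :=
    (hg z hz).hasDerivAt.add_const c
  refine ⟨fun w => (hg y hy).localInverse _ _ _ hs (w - w⁻¹ + c), ?_, ?_, ?_⟩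
  · change (hg y hy).localInverse _ _ _ hs (z - z⁻¹ + c) = y
    rw [← h]
    exact himg
  · have h' := hinv.hasDerivAt
    simp only [h] at h'
    exact h'.comp z hin
  · simp only [h] at hright
    exact hin.continuousAt.eventually hright

theorem flipProd_univ {ι : Type} [Fintype ι] [DecidableEq ι] (y : ι → ℂ) :
    flipProd Finset.univ y = ∏ i, y i := by
  simp [flipProd]

theorem flipProd_eq_mul {ι : Type} [Fintype ι] [DecidableEq ι] (A : Finset ι) {y : ι → ℂ}
    (hy : ∀ i, y i ≠ 0) :
    flipProd A y = (∏ i, y i) * ∏ i ∈ Aᶜ, -(y i ^ 2)⁻¹ := by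
  have : ∏ i ∈ Aᶜ, -(y i ^ 2)⁻¹ = ∏ i, if i ∈ A then 1 else -(y i ^ 2)⁻¹ := by
    rw [Finset.prod_ite, Finset.prod_const_one, one_mul]
    congr 1
    ext; simp
  rw [this, flipProd, ← Finset.prod_mul_distrib]
  refine Finset.prod_congr rfl fun i _ => ?_
  have := hy i
  split_ifs
  · rw [mul_one]
  · field_simp

/-- The nondegeneracy conditions on a solution `(z, y)`: no other sign choice over `z` solves the
system, and the eliminant has a simple root at `z`. -/
def Nondegenerate {ι : Type} [Fintype ι] (z : ℂ) (y : ι → ℂ) : Prop :=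
  (∀ S : Finset ι, S.Nonempty → ∏ i ∈ S, -(y i ^ 2)⁻¹ ≠ 1) ∧
    1 + (z + z⁻¹) * ∑ i, y i / (y i ^ 2 + 1) ≠ 0

open Polynomial in
theorem eval_derivative_ne_zero {ι : Type} [Fintype ι] [DecidableEq ι] {c : ι → ℂ} {p : ℂ[X]}
    {M : ℕ} (hp : ∀ z ≠ 0, ∀ y, LiesOver c z y →
      p.eval z = z ^ M * ∏ A : Finset ι, (1 - z * flipProd A y))
    {z : ℂ} (hz : z ≠ 0) {y : ι → ℂ} (hy : LiesOver c z y) (hzy : z * ∏ i, y i = 1)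
    (hnd : Nondegenerate z y) : p.derivative.eval z ≠ 0 := by
  have hs : ∀ i, 1 + (y i ^ 2)⁻¹ ≠ 0 := fun i h => hnd.1 {i} (Finset.singleton_nonempty i) (by
    rw [Finset.prod_singleton]
    linear_combination (-1) * h)
  choose v hvz hvd hv using fun i => exists_hasDerivAt_branch (c i) hz (hy i).1 (hy i).2 (hs i)
  have hv0 : ∀ i, ∀ᶠ w in 𝓝 z, v i w ≠ 0 := fun i =>
    (hvd i).continuousAt.eventually_ne (by rw [hvz]; exact (hy i).1)
  have hdiff : ∀ A : Finset ι, DifferentiableAt ℂ (fun w => flipProd A fun i => v i w) z := by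
    intro A
    unfold flipProd
    refine DifferentiableAt.fun_finsetProd fun i _ => ?_
    split_ifs
    · exact (hvd i).differentiableAt
    · exact ((hvd i).differentiableAt.inv (by rw [hvz]; exact (hy i).1)).neg
  set K : ℂ → ℂ := fun w =>
    w ^ M * ∏ A ∈ Finset.univ.erase Finset.univ, (1 - w * flipProd A fun i => v i w) with hK
  have hKd : DifferentiableAt ℂ K z := by
    refine (differentiableAt_id.pow M).mul (DifferentiableAt.fun_finsetProd fun A _ => ?_)
    exact (differentiableAt_const 1).sub (differentiableAt_id.mul (hdiff A))
  have hvy : (fun i => v i z) = y := funext hvz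
  have hK0 : K z ≠ 0 := by
    refine mul_ne_zero (pow_ne_zero _ hz) (Finset.prod_ne_zero_iff.2 fun A hA => ?_)
    rw [hvy, flipProd_eq_mul A fun i => (hy i).1, ← mul_assoc, hzy, one_mul]
    refine sub_ne_zero.2 (hnd.1 _ ?_).symm
    rw [Finset.nonempty_iff_ne_empty, Ne, Finset.compl_eq_empty_iff]
    exact Finset.ne_of_mem_erase hA
  have hφ : HasDerivAt (fun w => 1 - w * ∏ i, v i w)
      (-(z⁻¹ * (1 + (z + z⁻¹) * ∑ i, y i / (y i ^ 2 + 1)))) z := by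
    have h1 := HasDerivAt.fun_finsetProd (u := Finset.univ) fun i _ => hvd i
    have h2 := ((hasDerivAt_id z).mul h1).const_sub 1
    refine h2.congr_deriv ?_
    simp only [hvz, id, one_mul, smul_eq_mul]
    have hP : ∏ i, y i = z⁻¹ := eq_inv_of_mul_eq_one_right hzy
    have hPe : ∀ i, ∏ j ∈ Finset.univ.erase i, y j = z⁻¹ * (y i)⁻¹ := by
      intro i
      rw [← hP, ← Finset.mul_prod_erase _ _ (Finset.mem_univ i), mul_comm (y i),
        mul_inv_cancel_right₀ (hy i).1]
    rw [hP, mul_add, mul_one, ← mul_assoc z⁻¹, Finset.mul_sum, Finset.mul_sum]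
    congr 2
    refine Finset.sum_congr rfl fun i _ => ?_
    rw [hPe]
    have h0 := (hy i).1
    have h3 : y i ^ 2 + 1 ≠ 0 := by
      have := hs i
      field_simp at this
      exact (div_ne_zero_iff.1 this).1
    have h4 : (1 + (y i ^ 2)⁻¹)⁻¹ = y i ^ 2 / (y i ^ 2 + 1) := by
      field_simp
    rw [h4]
    field_simp
  have heq : (fun w => p.eval w) =ᶠ[𝓝 z] fun w => (1 - w * ∏ i, v i w) * K w := by
    filter_upwards [Filter.eventually_all.2 hv, Filter.eventually_all.2 hv0,
      isOpen_ne.mem_nhds hz] with w h1 h2 hw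
    rw [hp w hw (fun i => v i w) fun i => ⟨h2 i, h1 i⟩, hK,
      ← Finset.mul_prod_erase _ _ (Finset.mem_univ (Finset.univ : Finset ι)), flipProd_univ]
    ring
  have hd1 := (hφ.mul hKd.hasDerivAt).congr_of_eventuallyEq heq
  have hd2 := p.hasDerivAt z
  rw [hd2.unique hd1]
  simp only [hvz, hzy, sub_self, zero_mul, add_zero]
  exact mul_ne_zero (neg_ne_zero.2 (mul_ne_zero (inv_ne_zero hz) hnd.2)) hK0

open Polynomial in
theorem card_roots_toFinset_erase_zero {p : ℂ[X]} (hp : p ≠ 0)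
    (hsimple : ∀ z ≠ 0, p.IsRoot z → p.derivative.eval z ≠ 0) :
    (p.roots.toFinset.erase 0).card + p.rootMultiplicity 0 = p.natDegree := by
  rw [← IsAlgClosed.card_roots_eq_natDegree, ← Multiset.toFinset_sum_count_eq, ← count_roots]
  have h1 : ∀ z ∈ p.roots.toFinset.erase 0, p.roots.count z = 1 := by
    intro z hz
    rw [Finset.mem_erase, Multiset.mem_toFinset, mem_roots hp] at hz
    rw [count_roots]
    refine le_antisymm ?_ ((rootMultiplicity_pos hp).2 hz.2)
    by_contra! h
    exact hsimple z hz.1 hz.2 ((one_lt_rootMultiplicity_iff_isRoot hp).1 h).2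
  have h2 : ∑ z ∈ p.roots.toFinset.erase 0, p.roots.count z = (p.roots.toFinset.erase 0).card := by
    rw [Finset.sum_congr rfl h1]; simp
  rw [← h2]
  by_cases h0 : (0 : ℂ) ∈ p.roots.toFinset
  · exact Finset.sum_erase_add _ _ h0
  · rw [Finset.erase_eq_of_notMem h0, Multiset.count_eq_zero.2 (by simpa using h0), add_zero]

theorem ncard_solutions {ι : Type} [Fintype ι] [DecidableEq ι] (hι : 1 ≤ Fintype.card ι)
    (c : ι → ℂ) (hc : ∀ A : Finset ι, (∑ i, if i ∈ A then c i else -c i) ≠ 0)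
    (hnd : ∀ z ≠ 0, ∀ y, LiesOver c z y → z * ∏ i, y i = 1 → Nondegenerate z y) :
    {z : ℂ | z ≠ 0 ∧ ∃ y, LiesOver c z y ∧ z * ∏ i, y i = 1}.Finite ∧
    {z : ℂ | z ≠ 0 ∧ ∃ y, LiesOver c z y ∧ z * ∏ i, y i = 1}.ncard =
      if 4 ∣ Fintype.card ι + 1 then
        (Fintype.card ι + 1 - 2) * (Fintype.card ι).choose ((Fintype.card ι + 1) / 2 - 1)
      else (Fintype.card ι + 1) * (Fintype.card ι).choose (Fintype.card ι / 2) := by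
  obtain ⟨p, hp⟩ := exists_eliminant c hι
  set n := Fintype.card ι
  set M := (n - 1) * 2 ^ n
  obtain ⟨u, hu, htend⟩ := exists_tendsto_prod c hc
  obtain ⟨l₁, hl₁, ht₁⟩ := htend 1 (Or.inl rfl)
  obtain ⟨l₂, hl₂, ht₂⟩ := htend (-1) (Or.inr rfl)
  set κ₁ := ∑ A : Finset ι, growth n (2 * A.card - n + 1)
  set κ₂ := ∑ A : Finset ι, growth n (2 * A.card - n + (-1))
  have hp₁ : Tendsto (fun w => p.eval w * w ^ (-(M + κ₁))) (cobounded ℂ) (𝓝 l₁) := by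
    refine ht₁.congr' ?_
    filter_upwards [eventually_ne_cobounded 0] with w hw
    rw [hp w hw _ (hu w), neg_add, zpow_add₀ hw, zpow_neg w (M : ℤ), zpow_natCast]
    simp only [Int.cast_one, one_mul, zpow_one]
    field_simp
  have hp₂ : Tendsto (fun w => p.eval (-w⁻¹) * w ^ (-(κ₂ - M))) (cobounded ℂ)
      (𝓝 ((-1) ^ M * l₂)) := by
    refine (ht₂.const_mul ((-1) ^ M)).congr' ?_
    filter_upwards [eventually_ne_cobounded 0] with w hw
    have hlies : LiesOver c (-w⁻¹) (u w) := fun i =>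
      ⟨(hu w i).1, by rw [(hu w i).2, inv_neg, inv_inv]; ring⟩
    rw [hp _ (neg_ne_zero.2 (inv_ne_zero hw)) _ hlies, neg_sub, sub_eq_add_neg, zpow_add₀ hw,
      zpow_natCast, neg_pow w⁻¹, inv_pow]
    simp only [Int.cast_neg, Int.cast_one, zpow_neg_one, neg_mul, one_mul]
    field_simp
  have hp0 : p ≠ 0 := by
    rintro rfl
    simp only [Polynomial.eval_zero, zero_mul] at hp₁
    exact hl₁ (tendsto_nhds_unique hp₁ tendsto_const_nhds)
  have hdeg : (p.natDegree : ℤ) = M + κ₁ :=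
    eq_of_tendsto_mul_zpow (Polynomial.leadingCoeff_ne_zero.2 hp0) hl₁
      (tendsto_eval_mul_zpow_natDegree p) hp₁
  have hord : -(p.rootMultiplicity 0 : ℤ) = κ₂ - M := by
    obtain ⟨l, hl, ht⟩ := tendsto_eval_neg_inv_mul_zpow p hp0
    exact eq_of_tendsto_mul_zpow hl (mul_ne_zero (pow_ne_zero _ (by norm_num)) hl₂)
      (by simpa using ht) hp₂
  have hroot : ∀ z ≠ 0, p.IsRoot z ↔ ∃ y, LiesOver c z y ∧ z * ∏ i, y i = 1 := by
    intro z hz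
    rw [Polynomial.IsRoot.def]
    constructor
    · intro h
      choose y hy1 hy using fun i => exists_sub_inv_eq (z - z⁻¹ + c i)
      have hy0 : ∀ i, y i ≠ 0 := fun i h0 => by
        have := hy1 i
        rw [h0, norm_zero] at this
        linarith
      rw [hp z hz y fun i => ⟨hy0 i, hy i⟩, mul_eq_zero, or_iff_right (pow_ne_zero _ hz),
        Finset.prod_eq_zero_iff] at h
      obtain ⟨A, -, hA⟩ := h
      refine ⟨fun i => if i ∈ A then y i else -(y i)⁻¹, fun i => ?_, (sub_eq_zero.1 hA).symm⟩
      dsimp only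
      split_ifs
      · exact ⟨hy0 i, hy i⟩
      · refine ⟨neg_ne_zero.2 (inv_ne_zero (hy0 i)), ?_⟩
        rw [← hy i, inv_neg, inv_inv]
        ring
    · rintro ⟨y, hy, hzy⟩
      rw [hp z hz y hy, Finset.prod_eq_zero (Finset.mem_univ Finset.univ), mul_zero]
      rw [flipProd_univ, hzy, sub_self]
  have hset : {z : ℂ | z ≠ 0 ∧ ∃ y, LiesOver c z y ∧ z * ∏ i, y i = 1} =
      ↑(p.roots.toFinset.erase 0) := by
    ext z
    simp only [Set.mem_ofPred_eq, Finset.coe_erase, Set.mem_sdiff, Finset.mem_coe,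
      Multiset.mem_toFinset, Polynomial.mem_roots hp0, Set.mem_singleton_iff]
    constructor
    · rintro ⟨hz, h⟩
      exact ⟨(hroot z hz).2 h, hz⟩
    · rintro ⟨h, hz⟩
      exact ⟨hz, (hroot z hz).1 h⟩
  have hcard := card_roots_toFinset_erase_zero hp0 fun z hz h => by
    obtain ⟨y, hy, hzy⟩ := (hroot z hz).1 h
    exact eval_derivative_ne_zero hp hz hy hzy (hnd z hz y hy hzy)
  rw [hset]
  refine ⟨Finset.finite_toSet _, ?_⟩
  rw [Set.ncard_coe_finset]
  have hsum : κ₁ + κ₂ = ∑ k ∈ Finset.range (n + 1), (n.choose k : ℤ) *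
      (growth n (2 * k - n + 1) + growth n (2 * k - n + (-1))) := by
    rw [← Finset.sum_add_distrib, ← Finset.powerset_univ,
      Finset.sum_powerset_apply_card
        (fun k => growth n (2 * k - n + 1) + growth n (2 * k - n + (-1)))]
    simp [n]
  rw [sum_growth n hι] at hsum
  zify at hcard
  rw [← @Nat.cast_inj ℤ, ← hsum]
  linarith

/-- The values `1, x 0, …, x (n - 1), 1, 1, …` along the cycle. -/
def pathVar {R : Type} [One R] {n : ℕ} (x : Fin n → R) : ℕ → R
  | 0 => 1
  | k + 1 => if h : k < n then x ⟨k, h⟩ else 1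

theorem map_pathVar {R S : Type} [Semiring R] [Semiring S] {n : ℕ} (f : R →+* S) (x : Fin n → R)
    (k : ℕ) : f (pathVar x k) = pathVar (fun i => f (x i)) k := by
  cases k with
  | zero => exact map_one f
  | succ k =>
    simp only [pathVar]
    split_ifs
    · rfl
    · exact map_one f

theorem kuraX_eq_pathVar {n : ℕ} (h : 0 < n + 1) (x : Fin n → ℂ) {k : ℕ} (hk : k ≤ n + 1) :
    kuraX (n + 1) h x k = pathVar x k := by
  rcases k with _ | k
  · simp [kuraX, pathVar]
  · simp only [kuraX, pathVar]
    by_cases hkn : k < n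
    · have : (k + 1) % (n + 1) = k + 1 := Nat.mod_eq_of_lt (by omega)
      rw [dif_neg (by omega), dif_pos hkn]
      congr 1
      ext
      simp [this]
    · obtain rfl : k = n := by omega
      rw [dif_pos (Nat.mod_self _), dif_neg hkn]

theorem pathVar_ne_zero {n : ℕ} {x : Fin n → ℂ} (hx : ∀ i, x i ≠ 0) (k : ℕ) : pathVar x k ≠ 0 := by
  cases k with
  | zero => exact one_ne_zero
  | succ k =>
    simp only [pathVar]
    split_ifs
    · exact hx _
    · exact one_ne_zero

theorem pathVar_succ_self {R : Type} [One R] {n : ℕ} (x : Fin n → R) : pathVar x (n + 1) = 1 := by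
  simp [pathVar]

theorem pathVar_succ {R : Type} [One R] {n : ℕ} (x : Fin n → R) (i : Fin n) :
    pathVar x (i + 1) = x i := by
  simp [pathVar]

/-- The ratios of consecutive values along the cycle. -/
def stepRatio {n : ℕ} (x : Fin n → ℂ) (i : Fin n) : ℂ := pathVar x (i + 1) / pathVar x i

theorem prod_ite_lt_succ {n : ℕ} (y : Fin n → ℂ) (i : Fin n) :
    (∏ j : Fin n, if j.val < i + 1 then y j else 1) =
      (∏ j : Fin n, if j.val < i then y j else 1) * y i := by
  have : y i = ∏ j : Fin n, if j = i then y j else 1 := by simp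
  conv_rhs => rw [this]
  rw [← Finset.prod_mul_distrib]
  refine Finset.prod_congr rfl fun j _ => ?_
  simp only [Fin.ext_iff]
  rcases lt_trichotomy j.val i.val with h | h | h
  · rw [if_pos (by omega), if_pos h, if_neg h.ne, mul_one]
  · rw [if_pos (by omega), if_neg (by omega), if_pos h, one_mul]
  · rw [if_neg (by omega), if_neg (by omega), if_neg (by omega), mul_one]

theorem pathVar_eq_prod {n : ℕ} {x : Fin n → ℂ} (hx : ∀ i, x i ≠ 0) {k : ℕ} (hk : k ≤ n) :
    pathVar x k = ∏ j : Fin n, if j.val < k then stepRatio x j else 1 := by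
  induction k with
  | zero => simp [pathVar]
  | succ k ih =>
    rw [prod_ite_lt_succ _ ⟨k, hk⟩, ← ih (by omega), stepRatio,
      mul_div_cancel₀ _ (pathVar_ne_zero hx _)]

theorem inv_mul_prod_stepRatio {n : ℕ} {x : Fin n → ℂ} (hx : ∀ i, x i ≠ 0) :
    (pathVar x n)⁻¹ * ∏ i, stepRatio x i = 1 := by
  have : pathVar x n = ∏ i, stepRatio x i := by
    simp [pathVar_eq_prod hx le_rfl]
  rw [← this, inv_mul_cancel₀ (pathVar_ne_zero hx _)]

theorem stepRatio_injective {n : ℕ} {x x' : Fin n → ℂ} (hx : ∀ i, x i ≠ 0) (hx' : ∀ i, x' i ≠ 0)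
    (h : stepRatio x = stepRatio x') : x = x' := by
  ext i
  rw [← pathVar_succ x, ← pathVar_succ x', pathVar_eq_prod hx i.2, pathVar_eq_prod hx' i.2, h]

theorem exists_stepRatio_eq {n : ℕ} {y : Fin n → ℂ} (hy : ∀ i, y i ≠ 0) :
    ∃ x : Fin n → ℂ, (∀ i, x i ≠ 0) ∧ pathVar x n = ∏ i, y i ∧ stepRatio x = y := by
  set x : Fin n → ℂ := fun i => ∏ j : Fin n, if j.val < i + 1 then y j else 1 with hxdef
  have hx : ∀ i, x i ≠ 0 := fun i => Finset.prod_ne_zero_iff.2 fun j _ => by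
    split_ifs
    · exact hy j
    · exact one_ne_zero
  have hpath : ∀ k ≤ n, pathVar x k = ∏ j : Fin n, if j.val < k then y j else 1 := by
    intro k hk
    cases k with
    | zero => simp [pathVar]
    | succ k => exact pathVar_succ x ⟨k, hk⟩
  refine ⟨x, hx, by simp [hpath n le_rfl], ?_⟩
  ext i
  rw [stepRatio, hpath _ i.2, prod_ite_lt_succ, ← hpath _ i.2.le,
    mul_div_cancel_left₀ _ (pathVar_ne_zero hx _)]

/-- The sum of the `ω j` over `j ≥ k`. -/
def tailSum {R : Type} [AddCommMonoid R] {n : ℕ} (ω : Fin n → R) (k : ℕ) : R :=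
  ∑ j : Fin n, if k ≤ j then ω j else 0

theorem map_tailSum {R S : Type} [Semiring R] [Semiring S] {n : ℕ} (f : R →+* S) (ω : Fin n → R)
    (k : ℕ) : f (tailSum ω k) = tailSum (fun i => f (ω i)) k := by
  simp only [tailSum, map_sum]
  exact Finset.sum_congr rfl fun j _ => by split_ifs <;> simp

theorem tailSum_self {n : ℕ} (ω : Fin n → ℂ) : tailSum ω n = 0 :=
  Finset.sum_eq_zero fun j _ => if_neg (by omega)

theorem tailSum_eq_add {n : ℕ} (ω : Fin n → ℂ) (i : Fin n) :
    tailSum ω i = ω i + tailSum ω (i + 1) := by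
  have : ω i = ∑ j : Fin n, if j = i then ω j else 0 := by simp
  conv_rhs => rw [this]
  rw [tailSum, tailSum, ← Finset.sum_add_distrib]
  refine Finset.sum_congr rfl fun j _ => ?_
  simp only [Fin.ext_iff]
  split_ifs <;> first | omega | simp

theorem kuraF_eq {n : ℕ} (h : 0 < n + 1) (ω : Fin n → ℂ) (a : ℂ) (i : Fin n) (x : Fin n → ℂ) :
    kuraF (n + 1) h ω a i x = ω i - a * (pathVar x (i + 1) / pathVar x i
      - pathVar x i / pathVar x (i + 1) + pathVar x (i + 1) / pathVar x (i + 2)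
      - pathVar x (i + 2) / pathVar x (i + 1)) := by
  have := i.2
  rw [kuraF, kuraX_eq_pathVar h x (by omega), kuraX_eq_pathVar h x (by omega),
    kuraX_eq_pathVar h x (by omega)]

theorem kuraF_eq_zero_iff {n : ℕ} (h : 0 < n + 1) (ω : Fin n → ℂ) {a : ℂ} (ha : a ≠ 0)
    {x : Fin n → ℂ} (hx : ∀ i, x i ≠ 0) :
    (∀ i, kuraF (n + 1) h ω a i x = 0) ↔
      LiesOver (fun i : Fin n => tailSum ω i / a) (pathVar x n)⁻¹ (stepRatio x) := by
  set γ : ℕ → ℂ := fun k => pathVar x (k + 1) / pathVar x k - pathVar x k / pathVar x (k + 1)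
    with hγ
  have h1 : ∀ i : Fin n, kuraF (n + 1) h ω a i x = 0 ↔ γ i - γ (i + 1) = ω i / a := by
    intro i
    rw [kuraF_eq, sub_eq_zero, eq_div_iff ha, eq_comm, mul_comm a, hγ]
    ring_nf
  have hlast : γ n = (pathVar x n)⁻¹ - (pathVar x n)⁻¹⁻¹ := by
    simp [hγ, pathVar_succ_self]
  have h2 : LiesOver (fun i : Fin n => tailSum ω i / a) (pathVar x n)⁻¹ (stepRatio x) ↔
      ∀ k ≤ n, γ k = γ n + tailSum ω k / a := by
    constructor
    · intro hl k hk
      rcases hk.lt_or_eq with hk | rfl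
      · rw [hlast, ← (hl ⟨k, hk⟩).2, stepRatio, inv_div]
      · rw [tailSum_self, zero_div, add_zero]
    · intro hl i
      refine ⟨div_ne_zero (pathVar_ne_zero hx _) (pathVar_ne_zero hx _), ?_⟩
      rw [← hlast, ← hl i i.2.le, stepRatio, inv_div]
  rw [h2]
  constructor
  · intro hF k hk
    induction hk using Nat.decreasingInduction with
    | self => rw [tailSum_self, zero_div, add_zero]
    | of_succ k hk ih =>
      have := (h1 ⟨k, hk⟩).1 (hF _)
      have h3 := tailSum_eq_add ω ⟨k, hk⟩
      simp only at this h3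
      rw [h3, add_div]
      linear_combination this + ih
  · intro hl i
    rw [h1, hl i i.2.le, hl (i + 1) i.2, tailSum_eq_add]
    ring

theorem LiesOver.eq_of_prod_eq {ι : Type} [Fintype ι] [DecidableEq ι] {c : ι → ℂ} {z : ℂ}
    {y y' : ι → ℂ} (hy : LiesOver c z y) (hy' : LiesOver c z y') (hprod : ∏ i, y i = ∏ i, y' i)
    (hnd : Nondegenerate z y) : y = y' := by
  have hdich : ∀ i, y' i = y i ∨ y' i = y i * -(y i ^ 2)⁻¹ := by
    intro i
    have h0 := (hy i).1
    have h0' := (hy' i).1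
    have h := (hy i).2.trans (hy' i).2.symm
    have : (y' i - y i) * (y' i * y i + 1) = 0 := by
      field_simp at h
      linear_combination -h
    rcases mul_eq_zero.1 this with h | h
    · exact Or.inl (sub_eq_zero.1 h)
    · right
      field_simp
      linear_combination h
  set S := Finset.univ.filter fun i => y' i ≠ y i with hS
  have hflip : ∏ i, y' i = (∏ i, y i) * ∏ i ∈ S, -(y i ^ 2)⁻¹ := by
    rw [hS, Finset.prod_filter, ← Finset.prod_mul_distrib]
    refine Finset.prod_congr rfl fun i _ => ?_
    split_ifs with h
    · exact (hdich i).resolve_left h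
    · rw [mul_one, not_not.1 h]
  have hS1 : ∏ i ∈ S, -(y i ^ 2)⁻¹ = 1 := by
    rw [← hprod] at hflip
    exact (mul_eq_left₀ (Finset.prod_ne_zero_iff.2 fun i _ => (hy i).1)).1 hflip.symm
  have hSe : S = ∅ := Finset.not_nonempty_iff_eq_empty.1 fun h => hnd.1 S h hS1
  ext i
  by_contra h
  have : i ∈ S := Finset.mem_filter.2 ⟨Finset.mem_univ i, Ne.symm h⟩
  simp [hSe] at this

theorem bijOn_solutions {n : ℕ} (h : 0 < n + 1) {ω : Fin n → ℂ} {a : ℂ} (ha : a ≠ 0)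
    (hnd : ∀ x : Fin n → ℂ, (∀ j, x j ≠ 0) → (∀ i, kuraF (n + 1) h ω a i x = 0) →
      Nondegenerate (pathVar x n)⁻¹ (stepRatio x)) :
    Set.BijOn (fun x => (pathVar x n)⁻¹)
      {x : Fin n → ℂ | (∀ j, x j ≠ 0) ∧ ∀ i, kuraF (n + 1) h ω a i x = 0}
      {z : ℂ | z ≠ 0 ∧ ∃ y, LiesOver (fun i : Fin n => tailSum ω i / a) z y ∧
        z * ∏ i, y i = 1} := by
  refine ⟨fun x hx => ?_, fun x hx x' hx' hxx' => ?_, fun z hz => ?_⟩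
  · exact ⟨inv_ne_zero (pathVar_ne_zero hx.1 n), stepRatio x,
      (kuraF_eq_zero_iff h ω ha hx.1).1 hx.2, inv_mul_prod_stepRatio hx.1⟩
  · have hl := (kuraF_eq_zero_iff h ω ha hx.1).1 hx.2
    have hl' := (kuraF_eq_zero_iff h ω ha hx'.1).1 hx'.2
    have hp := inv_mul_prod_stepRatio hx.1
    have hp' := inv_mul_prod_stepRatio hx'.1
    simp only at hxx'
    rw [← hxx'] at hl' hp'
    refine stepRatio_injective hx.1 hx'.1 (hl.eq_of_prod_eq hl' ?_ (hnd x hx.1 hx.2))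
    exact mul_left_cancel₀ (inv_ne_zero (pathVar_ne_zero hx.1 n)) (hp.trans hp'.symm)
  · obtain ⟨hz0, y, hy, hzy⟩ := hz
    obtain ⟨x, hx, hxn, hxy⟩ := exists_stepRatio_eq fun i => (hy i).1
    have hzx : (pathVar x n)⁻¹ = z := by
      rw [hxn, ← eq_inv_of_mul_eq_one_left hzy]
    exact ⟨x, ⟨hx, (kuraF_eq_zero_iff h ω ha hx).2 (by rwa [hzx, hxy])⟩, hzx⟩

theorem pathVar_dvd_prod {R : Type} [CommSemiring R] {n : ℕ} (x : Fin n → R) (k : ℕ) :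
    pathVar x k ∣ ∏ i, x i := by
  cases k with
  | zero => exact one_dvd _
  | succ k =>
    simp only [pathVar]
    split_ifs
    · exact Finset.dvd_prod_of_mem _ (Finset.mem_univ _)
    · exact one_dvd _

/-- Vanishes when flipping the signs in `S` keeps the product of the step ratios of `x`. -/
def flipObstruction {R : Type} [CommRing R] {n : ℕ} (S : Finset (Fin n)) (x : Fin n → R) : R :=
  ∏ i ∈ S, pathVar x (i + 1) ^ 2 - ∏ i ∈ S, -pathVar x i ^ 2

/-- The numerator of the second nondegeneracy condition for the step ratios of `x`. -/
def ramification {R : Type} [CommRing R] {n : ℕ} (x : Fin n → R) : R :=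
  pathVar x n * ∏ i : Fin n, (pathVar x (i + 1) ^ 2 + pathVar x i ^ 2) +
    (1 + pathVar x n ^ 2) * ∑ i : Fin n, pathVar x i * pathVar x (i + 1) *
      ∏ j ∈ Finset.univ.erase i, (pathVar x (j + 1) ^ 2 + pathVar x j ^ 2)

theorem map_flipObstruction {R S : Type} [CommRing R] [CommRing S] {n : ℕ} (f : R →+* S)
    (A : Finset (Fin n)) (x : Fin n → R) :
    f (flipObstruction A x) = flipObstruction A fun i => f (x i) := by
  simp [flipObstruction, map_prod, map_pathVar]

theorem map_ramification {R S : Type} [CommRing R] [CommRing S] {n : ℕ} (f : R →+* S)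
    (x : Fin n → R) : f (ramification x) = ramification fun i => f (x i) := by
  simp [ramification, map_prod, map_sum, map_pathVar]

theorem exists_flipObstruction_ne_zero {n : ℕ} {S : Finset (Fin n)} (hS : S.Nonempty) :
    ∃ x : Fin n → ℂ, flipObstruction S x ≠ 0 := by
  refine ⟨fun i => 2 ^ (i.val + 1), fun h => ?_⟩
  have hpath : ∀ k ≤ n, pathVar (fun i : Fin n => (2 : ℂ) ^ (i.val + 1)) k = 2 ^ k := by
    intro k hk
    cases k with
    | zero => simp [pathVar]
    | succ k => exact pathVar_succ _ ⟨k, hk⟩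
  rw [flipObstruction, sub_eq_zero] at h
  have h' := congrArg norm h
  simp only [norm_prod, norm_neg, norm_pow] at h'
  refine (Finset.prod_lt_prod_of_nonempty (fun i _ => ?_) (fun i _ => ?_) hS).ne' h'
  · rw [hpath _ i.2.le]
    simp
  · rw [hpath _ i.2.le, hpath _ i.2]
    simp only [norm_pow, Complex.norm_ofNat]
    gcongr <;> norm_num

theorem ramification_one_ne_zero {n : ℕ} : ramification (fun _ : Fin n => (1 : ℂ)) ≠ 0 := by
  have hpath : ∀ k, pathVar (fun _ : Fin n => (1 : ℂ)) k = 1 := by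
    intro k
    cases k <;> simp [pathVar]
  have : ramification (fun _ : Fin n => (1 : ℂ)) =
      ((2 ^ n + 2 * (n * 2 ^ (n - 1)) : ℕ) : ℂ) := by
    simp [ramification, hpath, Finset.card_erase_of_mem]
    norm_num
  rw [this, Nat.cast_ne_zero]
  positivity

theorem nondegenerate_stepRatio {n : ℕ} {x : Fin n → ℂ} (hx : ∀ i, x i ≠ 0)
    (hflip : ∀ S : Finset (Fin n), S.Nonempty → flipObstruction S x ≠ 0)
    (hram : ramification x ≠ 0) : Nondegenerate (pathVar x n)⁻¹ (stepRatio x) := by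
  have h0 := pathVar_ne_zero hx
  have hsq : ∀ i : Fin n, pathVar x (i + 1) ^ 2 + pathVar x i ^ 2 ≠ 0 := by
    intro i
    simpa [flipObstruction] using hflip {i} (Finset.singleton_nonempty i)
  refine ⟨fun S hS h => hflip S hS ?_, fun h => hram ?_⟩
  · have : ∏ i ∈ S, -pathVar x i ^ 2 =
        (∏ i ∈ S, pathVar x (i + 1) ^ 2) * ∏ i ∈ S, -(stepRatio x i ^ 2)⁻¹ := by
      rw [← Finset.prod_mul_distrib]
      refine Finset.prod_congr rfl fun i _ => ?_
      have h1 := h0 i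
      have h2 := h0 (i + 1)
      rw [stepRatio]
      field_simp
    rw [flipObstruction, this, h, mul_one, sub_self]
  · have hratio : ∀ i : Fin n, pathVar x i * pathVar x (i + 1) *
        ∏ j ∈ Finset.univ.erase i, (pathVar x (j + 1) ^ 2 + pathVar x j ^ 2) =
        (∏ j : Fin n, (pathVar x (j + 1) ^ 2 + pathVar x j ^ 2)) *
          (stepRatio x i / (stepRatio x i ^ 2 + 1)) := by
      intro i
      rw [← Finset.mul_prod_erase _ _ (Finset.mem_univ i), stepRatio]
      have h1 := h0 i
      have h3 := hsq i
      have h4 : (pathVar x (i + 1) / pathVar x i) ^ 2 + 1 =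
          (pathVar x (i + 1) ^ 2 + pathVar x i ^ 2) / pathVar x i ^ 2 := by
        field_simp
      rw [h4]
      field_simp
    have hn := h0 n
    rw [ramification, Finset.sum_congr rfl fun i _ => hratio i, ← Finset.mul_sum]
    rw [inv_inv] at h
    have h5 : pathVar x n + (1 + pathVar x n ^ 2) *
        ∑ i, stepRatio x i / (stepRatio x i ^ 2 + 1) = 0 := by
      have := congrArg (pathVar x n * ·) h
      simp only [mul_zero] at this
      rw [← this]
      field_simp
    linear_combination (∏ j : Fin n, (pathVar x (j + 1) ^ 2 + pathVar x j ^ 2)) * h5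

open MvPolynomial in
theorem exists_generic_nondegenerate (n : ℕ) (hn : 0 < n + 1) :
    ∃ P : MvPolynomial (Fin n ⊕ Unit) ℂ, P ≠ 0 ∧ ∀ (ω : Fin n → ℂ) (a : ℂ),
      eval (Sum.elim ω fun _ => a) P ≠ 0 → ∀ x : Fin n → ℂ, (∀ j, x j ≠ 0) →
        (∀ i, kuraF (n + 1) hn ω a i x = 0) →
          Nondegenerate (pathVar x n)⁻¹ (stepRatio x) := by
  set ξ : Fin n → MvPolynomial (Fin n ⊕ Unit) ℂ := fun i => X (Sum.inl i) with hξ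
  choose q hq using pathVar_dvd_prod ξ
  set c : Fin n ⊕ Unit → MvPolynomial (Fin n ⊕ Unit) ℂ := Sum.elim
    (fun i => X (Sum.inr ()) * (pathVar ξ (i + 1) * q i - pathVar ξ i * q (i + 1) +
      pathVar ξ (i + 1) * q (i + 2) - pathVar ξ (i + 2) * q (i + 1)))
    (fun _ => X (Sum.inr ()) * ∏ i, ξ i) with hcdef
  set h : MvPolynomial (Fin n ⊕ Unit) ℂ :=
    (∏ S ∈ Finset.univ.filter fun S : Finset (Fin n) => S.Nonempty, flipObstruction S ξ) *
      ramification ξ with hh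
  have hξe : ∀ (x : Fin n → ℂ) (b : ℂ),
      (fun i => eval (Sum.elim x fun _ => b) (ξ i)) = x := by
    intro x b
    ext i
    simp [hξ]
  have hh0 : h ≠ 0 := by
    refine mul_ne_zero (Finset.prod_ne_zero_iff.2 fun S hS h0 => ?_) fun h0 => ?_
    · obtain ⟨x, hx⟩ := exists_flipObstruction_ne_zero (Finset.mem_filter.1 hS).2
      refine hx ?_
      rw [← hξe x 0, ← map_flipObstruction, h0, map_zero]
    · refine ramification_one_ne_zero (n := n) ?_
      rw [← hξe (fun _ => 1) 0, ← map_ramification, h0, map_zero]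
  obtain ⟨P, hP0, r, hr⟩ := exists_dvd_aeval c hh0
  refine ⟨P, hP0, fun ω a hPe x hx hF => ?_⟩
  set b := a / ∏ i, x i with hb
  have hm : ∏ i, x i ≠ 0 := Finset.prod_ne_zero_iff.2 fun i _ => hx i
  set e := eval (Sum.elim x fun _ : Unit => b) with he
  have hqe : ∀ k, e (q k) = (∏ i, x i) / pathVar x k := by
    intro k
    have := congrArg e (hq k)
    rw [map_mul, map_pathVar, map_prod, hξe] at this
    rw [this, mul_div_cancel_left₀ _ (pathVar_ne_zero hx k)]
  have hce : (fun s => e (c s)) = Sum.elim ω fun _ => a := by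
    ext (i | u)
    · have hFi := hF i
      rw [kuraF_eq, sub_eq_zero] at hFi
      have h1 : e (X (Sum.inr ())) = b := by simp [he]
      simp only [hcdef, Sum.elim_inl, map_mul, map_sub, map_add, map_pathVar, hqe, h1]
      rw [hξe, hFi, hb]
      field_simp
    · have h1 : e (X (Sum.inr ())) = b := by simp [he]
      simp only [hcdef, Sum.elim_inr, map_mul, map_prod, h1]
      rw [Finset.prod_congr rfl fun i _ => congrFun (hξe x b) i, hb, div_mul_cancel₀ _ hm]
  have hhe : e h ≠ 0 := by
    intro h0
    refine hPe ?_
    have := congrArg e hr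
    have hid : e.comp (algebraMap ℂ (MvPolynomial (Fin n ⊕ Unit) ℂ)) = RingHom.id ℂ := by
      ext r
      simp [he, algebraMap_eq]
    rw [map_mul, h0, zero_mul, map_aeval, hce, hid] at this
    exact this
  rw [hh, map_mul, map_prod, map_ramification, hξe] at hhe
  refine nondegenerate_stepRatio hx (fun S hS => ?_) (right_ne_zero_of_mul hhe)
  have := Finset.prod_ne_zero_iff.1 (left_ne_zero_of_mul hhe) S
    (Finset.mem_filter.2 ⟨Finset.mem_univ S, hS⟩)
  rwa [map_flipObstruction, hξe] at this

open MvPolynomial in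
theorem exists_generic_tailSum (n : ℕ) (hn : 1 ≤ n) :
    ∃ P : MvPolynomial (Fin n ⊕ Unit) ℂ, P ≠ 0 ∧ ∀ (ω : Fin n → ℂ) (a : ℂ),
      eval (Sum.elim ω fun _ => a) P ≠ 0 → ∀ A : Finset (Fin n),
        (∑ i : Fin n, if i ∈ A then tailSum ω i else -tailSum ω i) ≠ 0 := by
  set ξ : Fin n → MvPolynomial (Fin n ⊕ Unit) ℂ := fun i => X (Sum.inl i) with hξ
  set L : Finset (Fin n) → MvPolynomial (Fin n ⊕ Unit) ℂ := fun A =>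
    ∑ i : Fin n, if i ∈ A then tailSum ξ i else -tailSum ξ i with hL
  have hLe : ∀ (ω : Fin n → ℂ) (a : ℂ) (A : Finset (Fin n)), eval (Sum.elim ω fun _ => a) (L A) =
      ∑ i : Fin n, if i ∈ A then tailSum ω i else -tailSum ω i := by
    intro ω a A
    rw [hL, map_sum]
    refine Finset.sum_congr rfl fun i _ => ?_
    rw [apply_ite (eval _), map_neg, map_tailSum]
    simp [hξ]
  refine ⟨∏ A, L A, Finset.prod_ne_zero_iff.2 fun A _ h => ?_, fun ω a h A => ?_⟩
  · have h1 := congrArg (eval (Sum.elim (Pi.single ⟨0, hn⟩ 1) fun _ => 0)) h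
    have h2 : ∀ i : Fin n, tailSum (Pi.single ⟨0, hn⟩ 1 : Fin n → ℂ) i =
        if i = ⟨0, hn⟩ then 1 else 0 := by
      intro i
      rw [tailSum, Finset.sum_eq_single ⟨0, hn⟩]
      · simp [Fin.ext_iff]
      · intro j _ hj
        simp [hj]
      · simp
    rw [hLe, map_zero, Finset.sum_eq_single ⟨0, hn⟩] at h1
    · rw [h2, if_pos rfl] at h1
      split_ifs at h1 <;> norm_num at h1
    · intro i _ hi
      rw [h2, if_neg hi, neg_zero, ite_self]
    · simp
  · rw [← hLe ω a]
    rw [map_prod] at h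
    exact Finset.prod_ne_zero_iff.1 h A (Finset.mem_univ A)

/-- For `N ≥ 3` and `n = N−1`, there is a nonzero polynomial `p` in the `n+1`
variables `(ω_1, …, ω_n, a)` such that whenever `p(ω, a) ≠ 0`, the set of solutions
`x ∈ (ℂ∖{0})^n` of the algebraic Kuramoto system for `C_N` with uniform coupling is finite,
with cardinality `N·C(N−1, ⌊(N−1)/2⌋)` if `4 ∤ N` and `(N−2)·C(N−1, N/2−1)` if `4 ∣ N`. -/
theorem kuramoto_cycle_uniform_root_count (N : ℕ) (hN : 3 ≤ N) :
    ∃ p : MvPolynomial (Fin (N - 1) ⊕ Unit) ℂ, p ≠ 0 ∧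
      ∀ (ω : Fin (N - 1) → ℂ) (a : ℂ),
        MvPolynomial.eval (Sum.elim ω fun _ => a) p ≠ 0 →
        ({x : Fin (N - 1) → ℂ | (∀ j, x j ≠ 0) ∧
            ∀ i, kuraF N (by omega) ω a i x = 0} : Set (Fin (N - 1) → ℂ)).Finite ∧
        ({x : Fin (N - 1) → ℂ | (∀ j, x j ≠ 0) ∧
            ∀ i, kuraF N (by omega) ω a i x = 0} : Set (Fin (N - 1) → ℂ)).ncard =
          if 4 ∣ N then (N - 2) * Nat.choose (N - 1) (N / 2 - 1)
          else N * Nat.choose (N - 1) ((N - 1) / 2) := by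
  obtain ⟨n, rfl⟩ : ∃ n, N = n + 1 := ⟨N - 1, by omega⟩
  obtain ⟨P, hP0, hP⟩ := exists_generic_nondegenerate n (by omega)
  obtain ⟨Q, hQ0, hQ⟩ := exists_generic_tailSum n (by omega)
  set Y : MvPolynomial (Fin n ⊕ Unit) ℂ := MvPolynomial.X (Sum.inr ())
  refine ⟨P * Y * Q,
    mul_ne_zero (mul_ne_zero hP0 (MvPolynomial.X_ne_zero _)) hQ0, fun ω a h => ?_⟩
  rw [map_mul, map_mul, MvPolynomial.eval_X, Sum.elim_inr] at h
  have ha : a ≠ 0 := right_ne_zero_of_mul (left_ne_zero_of_mul h)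
  have hbij := bijOn_solutions (by omega) ha
    (hP ω a (left_ne_zero_of_mul (left_ne_zero_of_mul h)))
  have hc : ∀ A : Finset (Fin n),
      (∑ i : Fin n, if i ∈ A then tailSum ω i / a else -(tailSum ω i / a)) ≠ 0 := by
    intro A
    have : (∑ i : Fin n, if i ∈ A then tailSum ω i / a else -(tailSum ω i / a)) =
        (∑ i : Fin n, if i ∈ A then tailSum ω i else -tailSum ω i) / a := by
      rw [Finset.sum_div]
      exact Finset.sum_congr rfl fun i _ => by split_ifs <;> ring
    rw [this]
    exact div_ne_zero (hQ ω a (right_ne_zero_of_mul h) A) ha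
  obtain ⟨hfin, hcard⟩ := ncard_solutions (by rw [Fintype.card_fin]; omega) _ hc (by
    intro z hz y hy hzy
    obtain ⟨x, hx, rfl⟩ := hbij.surjOn ⟨hz, y, hy, hzy⟩
    have hl := (kuraF_eq_zero_iff (by omega) ω ha hx.1).1 hx.2
    have hnd := hP ω a (left_ne_zero_of_mul (left_ne_zero_of_mul h)) x hx.1 hx.2
    have hprod := (inv_mul_prod_stepRatio hx.1).trans hzy.symm
    rwa [← hl.eq_of_prod_eq hy (mul_left_cancel₀ hz hprod) hnd])
  refine ⟨hbij.finite_iff_finite.2 hfin, hbij.ncard_eq.trans ?_⟩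
  rw [hcard, Fintype.card_fin]
  rfl
end
end

section
/- Let N ≥ 3 and n = N−1. There exist a nonzero polynomial p in n+1 complex variables and a natural number k such that for every (ω_1,…,ω_n, a) ∈ ℂ^n × ℂ with p(ω_1,…,ω_n, a) ≠ 0: the set of solutions x ∈ (ℂ∖{0})^n of the algebraic Kuramoto system for C_N with uniform coupling is finite of cardinality exactly k, and at every solution the n×n Jacobian matrix (∂f_i/∂x_j)_{i,j=1}^n (each f_i being a holomorphic function on (ℂ∖{0})^n) is invertible. -/
open Complex

noncomputable section

/-- The Jacobian matrix of the system, `(∂f_i/∂x_j)`, at a point `x`, where the partial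
derivative is the complex derivative of the one-variable slice `t ↦ f_i(x with x_j := t)`. -/
def kuraJac (N : ℕ) (hN : 0 < N) (ω : Fin (N - 1) → ℂ) (a : ℂ) (x : Fin (N - 1) → ℂ) :
    Matrix (Fin (N - 1)) (Fin (N - 1)) ℂ :=
  Matrix.of fun i j => deriv (fun t => kuraF N hN ω a i (Function.update x j t)) (x j)

section
variable {B A : Type*} [CommRing B] [IsDomain B] [CommRing A] [IsDomain A] [Algebra B A]

open Polynomial

/-- An algebraic extension of domains of characteristic zero that is essentially of finite type
is, up to denominators in the base, generated by a single integral element. -/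
theorem exists_isIntegral_forall_smul_eq_aeval [CharZero B] [FaithfulSMul B A]
    [Algebra.EssFiniteType B A] [Algebra.IsAlgebraic B A] :
    ∃ θ : A, IsIntegral B θ ∧ ∀ g : A, ∃ b : B, b ≠ 0 ∧ ∃ P : B[X], b • g = aeval θ P := by
  let K := FractionRing B
  let L := FractionRing A
  let _ : Algebra K L := FractionRing.liftAlgebra B L
  have : IsScalarTower B K L := FractionRing.isScalarTower_liftAlgebra B L
  have hBL : Algebra.IsAlgebraic B L := (IsFractionRing.isAlgebraic_iff' B A L).1 inferInstance
  have : Algebra.IsAlgebraic K L := (IsFractionRing.comap_isAlgebraic_iff (A := B)).1 hBL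
  have : Algebra.EssFiniteType A L := .of_isLocalization L (nonZeroDivisors A)
  have : Algebra.EssFiniteType B L := .comp B A L
  have : Algebra.EssFiniteType K L := .of_comp B K L
  have : Module.Finite K L := Algebra.finite_of_essFiniteType_of_isAlgebraic
  have : CharZero K := charZero_of_injective_algebraMap (IsFractionRing.injective B K)
  have hK : Function.Injective (algebraMap B K) := IsFractionRing.injective B K
  have hL : Function.Injective (algebraMap A L) := IsFractionRing.injective A L
  obtain ⟨α, hα⟩ := Field.exists_primitive_element K L
  obtain ⟨u, v, hv, rfl⟩ := IsFractionRing.div_surjective (A := A) α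
  obtain ⟨c, d, hd, hcd⟩ :=
    Algebra.IsAlgebraic.exists_smul_eq_mul B u (nonZeroDivisors.ne_zero hv)
  obtain ⟨e, he, hint⟩ := (Algebra.IsAlgebraic.isAlgebraic (R := B) c).exists_integral_multiple
  refine ⟨e • c, hint, fun g => ?_⟩
  have hθ : algebraMap A L (e • c) =
      algebraMap K L (algebraMap B K (e * d)) * (algebraMap A L u / algebraMap A L v) := by
    have hv' : algebraMap A L v ≠ 0 := by
      simpa using (map_ne_zero_iff _ hL).2 (nonZeroDivisors.ne_zero hv)
    have := congrArg (algebraMap A L) hcd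
    simp only [Algebra.smul_def, map_mul, ← IsScalarTower.algebraMap_apply] at this ⊢
    rw [← mul_div_assoc, eq_div_iff hv']
    linear_combination (-algebraMap B L e) * this
  have htop : Algebra.adjoin K {algebraMap A L (e • c)} = ⊤ := by
    apply Algebra.adjoin_eq_top_of_primitive_element
    · exact Algebra.IsAlgebraic.isAlgebraic _
    rw [eq_top_iff, ← hα, IntermediateField.adjoin_simple_le_iff]
    have hne : algebraMap K L (algebraMap B K (e * d)) ≠ 0 := by
      rw [_root_.map_ne_zero, map_ne_zero_iff _ hK]
      exact mul_ne_zero he hd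
    rw [← mul_div_cancel_left₀ (algebraMap A L u / algebraMap A L v) hne, ← hθ]
    exact div_mem (IntermediateField.mem_adjoin_simple_self _ _)
      (IntermediateField.algebraMap_mem _ _)
  have hg : algebraMap A L g ∈ Algebra.adjoin K {algebraMap A L (e • c)} := htop ▸ trivial
  rw [Algebra.adjoin_singleton_eq_range_aeval] at hg
  obtain ⟨p, hp⟩ := hg
  obtain ⟨b, hb, hbp⟩ := IsLocalization.integerNormalization_spec (nonZeroDivisors B) p
  refine ⟨b, nonZeroDivisors.ne_zero hb,
    IsLocalization.integerNormalization (nonZeroDivisors B) p, hL ?_⟩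
  have hp' : aeval (algebraMap A L (e • c)) p = algebraMap A L g := hp
  rw [← aeval_algebraMap_apply, ← aeval_map_algebraMap K, hbp,
    Algebra.smul_def b g, Algebra.smul_def b p, map_mul, map_mul, hp',
    IsScalarTower.algebraMap_apply B K K[X], algebraMap_eq, aeval_C,
    ← IsScalarTower.algebraMap_apply, ← IsScalarTower.algebraMap_apply]

omit [IsDomain A] in
/-- For algebras of finite type the denominators in the base may be taken to be powers of a single
element. -/
theorem exists_ne_zero_forall_pow_smul_eq_aeval [Algebra.FiniteType B A] {θ : A}
    (h : ∀ g : A, ∃ b : B, b ≠ 0 ∧ ∃ P : B[X], b • g = aeval θ P) :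
    ∃ b : B, b ≠ 0 ∧ ∀ g : A, ∃ m : ℕ, ∃ P : B[X], b ^ m • g = aeval θ P := by
  obtain ⟨S, hS⟩ := ‹Algebra.FiniteType B A›
  choose β hβ P hP using h
  refine ⟨∏ s ∈ S, β s, Finset.prod_ne_zero_iff.2 fun s _ => hβ s, fun g => ?_⟩
  have hg : g ∈ Algebra.adjoin B (S : Set A) := hS ▸ trivial
  induction hg using Algebra.adjoin_induction with
  | mem s hs =>
    obtain ⟨r, hr⟩ := Finset.dvd_prod_of_mem β (Finset.mem_coe.1 hs)
    exact ⟨1, C r * P s, by rw [pow_one, hr, mul_comm, mul_smul, hP]; simp [Algebra.smul_def]⟩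
  | algebraMap r => exact ⟨0, C r, by simp⟩
  | add x y _ _ hx hy =>
    obtain ⟨m, P, hP⟩ := hx
    obtain ⟨l, Q, hQ⟩ := hy
    refine ⟨m + l, C ((∏ s ∈ S, β s) ^ l) * P + C ((∏ s ∈ S, β s) ^ m) * Q, ?_⟩
    simp only [map_add, map_mul, aeval_C, ← hP, ← hQ, Algebra.smul_def, pow_add]
    ring
  | mul x y _ _ hx hy =>
    obtain ⟨m, P, hP⟩ := hx
    obtain ⟨l, Q, hQ⟩ := hy
    refine ⟨m + l, P * Q, ?_⟩
    simp only [map_mul, ← hP, ← hQ, Algebra.smul_def, pow_add]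
    ring

theorem exists_bezout_minpoly_derivative [CharZero B] [IsIntegrallyClosed B] [FaithfulSMul B A]
    {θ : A} (hθ : IsIntegral B θ) :
    ∃ b : B, b ≠ 0 ∧ ∃ U V : B[X],
      U * minpoly B θ + V * derivative (minpoly B θ) = C b := by
  let K := FractionRing B
  let L := FractionRing A
  let _ : Algebra K L := FractionRing.liftAlgebra B L
  have : IsScalarTower B K L := FractionRing.isScalarTower_liftAlgebra B L
  have hK : Function.Injective (algebraMap B K) := IsFractionRing.injective B K
  have : CharZero K := charZero_of_injective_algebraMap hK
  have hL : Function.Injective (algebraMap A L) := IsFractionRing.injective A L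
  have hθL : IsIntegral B (algebraMap A L θ) := hθ.algebraMap
  have hmin : minpoly K (algebraMap A L θ) = (minpoly B θ).map (algebraMap B K) := by
    rw [minpoly.isIntegrallyClosed_eq_field_fractions K L hθ]
  have hsep : (minpoly K (algebraMap A L θ)).Separable :=
    (minpoly.irreducible (hθL.tower_top)).separable
  rw [hmin] at hsep
  obtain ⟨u, v, huv⟩ := hsep
  obtain ⟨b, hb, hbu⟩ := IsLocalization.integerNormalization_spec (nonZeroDivisors B) u
  obtain ⟨c, hc, hcv⟩ := IsLocalization.integerNormalization_spec (nonZeroDivisors B) v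
  refine ⟨b * c, mul_ne_zero (nonZeroDivisors.ne_zero hb) (nonZeroDivisors.ne_zero hc),
    C c * IsLocalization.integerNormalization (nonZeroDivisors B) u,
    C b * IsLocalization.integerNormalization (nonZeroDivisors B) v,
    map_injective _ hK ?_⟩
  simp only [Polynomial.map_add, Polynomial.map_mul, hbu, hcv, map_C, Algebra.smul_def,
    ← derivative_map, IsScalarTower.algebraMap_apply B K K[X], map_mul]
  linear_combination (C (algebraMap B K b) * C (algebraMap B K c)) * huv

omit [IsDomain B] [IsDomain A] in
theorem map_aeval_eq_eval₂ {E : Type*} [CommRing E] (ψ : A →+* E) (θ : A) (P : B[X]) :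
    ψ (aeval θ P) = P.eval₂ (ψ.comp (algebraMap B A)) (ψ θ) := by
  rw [aeval_def, hom_eval₂]

/-- If `A` is generated by an integral `θ` up to powers of `b`, then a root of the specialized
minimal polynomial of `θ` extends to a point of `A`. -/
theorem exists_ringHom_of_eval₂_minpoly_eq_zero [IsIntegrallyClosed B] [FaithfulSMul B A]
    {E : Type*} [Field E] {θ : A} (hθ : IsIntegral B θ) {b : B}
    (hb : ∀ g : A, ∃ m : ℕ, ∃ P : B[X], b ^ m • g = aeval θ P)
    (φ : B →+* E) (hφ : φ b ≠ 0) {t : E} (ht : (minpoly B θ).eval₂ φ t = 0) :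
    ∃ ψ : A →+* E, ψ.comp (algebraMap B A) = φ ∧ ψ θ = t := by
  choose m P hP using hb
  have key : ∀ {Q R : B[X]}, aeval θ Q = aeval θ R → Q.eval₂ φ t = R.eval₂ φ t := by
    intro Q R h
    have h0 : aeval θ (Q - R) = 0 := by rw [map_sub, h, sub_self]
    obtain ⟨S, hS⟩ := minpoly.isIntegrallyClosed_dvd hθ h0
    have := congrArg (eval₂ φ t) hS
    rw [eval₂_sub, eval₂_mul, ht, zero_mul] at this
    exact sub_eq_zero.1 this
  have hval : ∀ (g : A) (l : ℕ) (Q : B[X]), b ^ l • g = aeval θ Q →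
      (P g).eval₂ φ t / φ b ^ m g = Q.eval₂ φ t / φ b ^ l := by
    intro g l Q h
    have h1 : aeval θ (C (b ^ l) * P g) = aeval θ (C (b ^ m g) * Q) := by
      simp only [map_mul, aeval_C, ← h, ← hP, Algebra.smul_def]
      ring
    have h2 := key h1
    rw [eval₂_mul, eval₂_mul, eval₂_C, eval₂_C, map_pow, map_pow] at h2
    rw [div_eq_div_iff (pow_ne_zero _ hφ) (pow_ne_zero _ hφ)]
    linear_combination h2
  have hbase : ∀ r : B, (P (algebraMap B A r)).eval₂ φ t / φ b ^ m (algebraMap B A r) = φ r :=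
    fun r => by simpa using hval (algebraMap B A r) 0 (C r) (by simp)
  refine ⟨{ toFun := fun g => (P g).eval₂ φ t / φ b ^ m g
            map_one' := by simpa using hbase 1
            map_zero' := by simpa using hbase 0
            map_mul' := fun x y => ?_
            map_add' := fun x y => ?_ }, RingHom.ext hbase, ?_⟩
  · rw [hval (x * y) (m x + m y) (P x * P y), eval₂_mul, pow_add, mul_div_mul_comm]
    simp only [map_mul, ← hP, Algebra.smul_def, pow_add]
    ring
  · rw [hval (x + y) (m x + m y) (C (b ^ m y) * P x + C (b ^ m x) * P y)]
    · rw [eval₂_add, eval₂_mul, eval₂_mul, eval₂_C, eval₂_C, map_pow, map_pow, pow_add]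
      field_simp
    · simp only [map_add, map_mul, aeval_C, ← hP, Algebra.smul_def, pow_add]
      ring
  · simpa using hval θ 0 X (by simp)

/-- Generic étaleness on points: over a nonempty principal open subset of the base, the number of
geometric points of the fibres is constant and there are no vertical tangent vectors. -/
theorem exists_ne_zero_forall_fiber [CharZero B] [IsIntegrallyClosed B] [FaithfulSMul B A]
    [Algebra.FiniteType B A] [Algebra.IsAlgebraic B A] (E : Type*) [Field E] [IsAlgClosed E] :
    ∃ b : B, b ≠ 0 ∧ ∃ k : ℕ, ∀ φ : B →+* E, φ b ≠ 0 →
      {ψ : A →+* E | ψ.comp (algebraMap B A) = φ}.Finite ∧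
      {ψ : A →+* E | ψ.comp (algebraMap B A) = φ}.ncard = k ∧
      ∀ ψ : A →+* E, ψ.comp (algebraMap B A) = φ → ∀ d : A → E,
        (∀ g h, d (g + h) = d g + d h) → (∀ g h, d (g * h) = ψ g * d h + ψ h * d g) →
        (∀ r, d (algebraMap B A r) = 0) → ∀ g, d g = 0 := by
  classical
  obtain ⟨θ, hθ, hgen⟩ := exists_isIntegral_forall_smul_eq_aeval (B := B) (A := A)
  obtain ⟨b, hb, hbP⟩ := exists_ne_zero_forall_pow_smul_eq_aeval hgen
  obtain ⟨c, hc, U, V, hUV⟩ := exists_bezout_minpoly_derivative hθ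
  refine ⟨b * c, mul_ne_zero hb hc, (minpoly B θ).natDegree, fun φ hφ => ?_⟩
  rw [map_mul] at hφ
  have hφb := left_ne_zero_of_mul hφ
  have hφc := right_ne_zero_of_mul hφ
  have hmonic : ((minpoly B θ).map φ).Monic := (minpoly.monic hθ).map φ
  have hbez : ∀ t : E, (minpoly B θ).eval₂ φ t = 0 →
      V.eval₂ φ t * (derivative (minpoly B θ)).eval₂ φ t = φ c := by
    intro t ht
    have := congrArg (eval₂ φ t) hUV
    rwa [eval₂_add, eval₂_mul, eval₂_mul, ht, mul_zero, zero_add, eval₂_C] at this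
  have hnodup : ((minpoly B θ).map φ).roots.Nodup := by
    refine nodup_roots ((separable_def' _).2 ⟨C (φ c)⁻¹ * U.map φ, C (φ c)⁻¹ * V.map φ, ?_⟩)
    have h1 := congrArg (Polynomial.map φ) hUV
    rw [Polynomial.map_add, Polynomial.map_mul, Polynomial.map_mul, map_C, ← derivative_map] at h1
    have h2 : C (φ c)⁻¹ * C (φ c) = 1 := by rw [← C_mul, inv_mul_cancel₀ hφc, C_1]
    linear_combination C (φ c)⁻¹ * h1 + h2
  have hinj : Set.InjOn (fun ψ : A →+* E => ψ θ) {ψ | ψ.comp (algebraMap B A) = φ} := by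
    intro ψ hψ χ hχ h
    refine RingHom.ext fun g => ?_
    obtain ⟨m, P, hP⟩ := hbP g
    have h1 := map_aeval_eq_eval₂ ψ θ P
    have h2 := map_aeval_eq_eval₂ χ θ P
    have hr : ∀ r, ψ (algebraMap B A r) = φ r := fun r => RingHom.congr_fun hψ r
    have hr' : ∀ r, χ (algebraMap B A r) = φ r := fun r => RingHom.congr_fun hχ r
    rw [hψ, ← hP, Algebra.smul_def, map_mul, hr, map_pow] at h1
    rw [hχ, ← hP, Algebra.smul_def, map_mul, hr', map_pow, ← show ψ θ = χ θ from h, ← h1] at h2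
    exact (mul_left_cancel₀ (pow_ne_zero m hφb) h2).symm
  have himage : (fun ψ : A →+* E => ψ θ) '' {ψ | ψ.comp (algebraMap B A) = φ} =
      ((minpoly B θ).map φ).roots.toFinset := by
    ext t
    simp only [Set.mem_image, Set.mem_ofPred_eq, Finset.mem_coe, Multiset.mem_toFinset,
      mem_roots hmonic.ne_zero, IsRoot, eval_map]
    refine ⟨?_, fun ht => exists_ringHom_of_eval₂_minpoly_eq_zero hθ hbP φ hφb ht⟩
    rintro ⟨ψ, rfl, rfl⟩
    rw [← map_aeval_eq_eval₂, minpoly.aeval, map_zero]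
  refine ⟨?_, ?_, ?_⟩
  · exact Set.Finite.of_finite_image (himage ▸ Finset.finite_toSet _) hinj
  · rw [← hinj.ncard_image, himage, Set.ncard_coe_finset, Multiset.toFinset_card_of_nodup hnodup,
      ← (minpoly.monic hθ).natDegree_map φ]
    exact (IsAlgClosed.splits _).natDegree_eq_card_roots.symm
  · rintro ψ rfl d hadd hmul hbase g
    have hd1 : d 1 = 0 := by simpa using hbase 1
    have hdpoly : ∀ P : B[X], d (aeval θ P) = ψ (aeval θ (derivative P)) * d θ := by
      intro P
      induction P using Polynomial.induction_on' with
      | add P Q hP hQ => simp only [map_add, hadd, hP, hQ, add_mul]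
      | monomial n r =>
        have hpow : ∀ n : ℕ, d (θ ^ n) = n * ψ θ ^ (n - 1) * d θ := by
          intro n
          induction n with
          | zero => simpa using hd1
          | succ n ih =>
            rw [pow_succ, hmul, ih]
            rcases n with _ | n
            · simp
            · simp; ring
        simp only [aeval_monomial, derivative_monomial, hmul, hbase, hpow, map_mul, map_pow,
          map_natCast]
        ring
    have hdθ : d θ = 0 := by
      have h1 := hdpoly (minpoly B θ)
      rw [minpoly.aeval, show d 0 = 0 by simpa using hbase 0, map_aeval_eq_eval₂] at h1
      have h2 := hbez (ψ θ) (by rw [← map_aeval_eq_eval₂, minpoly.aeval, map_zero])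
      rcases mul_eq_zero.1 h1.symm with h | h
      · rw [h, mul_zero] at h2
        exact absurd h2.symm hφc
      · exact h
    obtain ⟨m, P, hP⟩ := hbP g
    have h := hdpoly P
    rw [hdθ, mul_zero, ← hP, Algebra.smul_def, hmul, hbase, mul_zero, add_zero, map_pow,
      map_pow] at h
    exact (mul_eq_zero.1 h).resolve_left (pow_ne_zero m hφb)
end

section
open MvPolynomial

/-- For a morphism from an irreducible affine variety to an affine space of at least the same
dimension, the number of points of a generic fibre is finite and constant, and there are no tangent
vectors along a generic fibre. -/
theorem exists_generic_fiber_of_trdeg_le {σ A : Type} [Fintype σ] [CommRing A] [IsDomain A]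
    [Algebra ℂ A] [Algebra.FiniteType ℂ A] (htr : Algebra.trdeg ℂ A ≤ Cardinal.mk σ)
    (f : MvPolynomial σ ℂ →ₐ[ℂ] A) :
    ∃ p : MvPolynomial σ ℂ, p ≠ 0 ∧ ∃ k : ℕ, ∀ c : σ → ℂ, eval c p ≠ 0 →
      {ψ : A →ₐ[ℂ] ℂ | ∀ s, ψ (f (X s)) = c s}.Finite ∧
      {ψ : A →ₐ[ℂ] ℂ | ∀ s, ψ (f (X s)) = c s}.ncard = k ∧
      ∀ ψ : A →ₐ[ℂ] ℂ, (∀ s, ψ (f (X s)) = c s) → ∀ d : A →ₗ[ℂ] ℂ,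
        (∀ g h, d (g * h) = ψ g * d h + ψ h * d g) → (∀ s, d (f (X s)) = 0) → d = 0 := by
  have hcomp : ∀ {c : σ → ℂ} {ψ : A →ₐ[ℂ] ℂ}, (∀ s, ψ (f (X s)) = c s) →
      ∀ p, ψ (f p) = eval c p := by
    intro c ψ h p
    have : ψ.comp f = aeval c := algHom_ext fun s => by simpa using h s
    rw [← AlgHom.comp_apply, this, aeval_eq_eval]
  by_cases hf : Function.Injective f
  · let _ : Algebra (MvPolynomial σ ℂ) A := f.toRingHom.toAlgebra
    have hmap : ∀ p, algebraMap (MvPolynomial σ ℂ) A p = f p := fun _ => rfl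
    have : IsScalarTower ℂ (MvPolynomial σ ℂ) A := .of_algebraMap_eq fun r => (f.commutes r).symm
    have : FaithfulSMul (MvPolynomial σ ℂ) A := (faithfulSMul_iff_algebraMap_injective _ _).2 hf
    have : Algebra.FiniteType (MvPolynomial σ ℂ) A := .of_restrictScalars_finiteType ℂ _ _
    have : Algebra.IsAlgebraic (MvPolynomial σ ℂ) A := by
      rw [← trdeg_eq_zero_iff]
      have h := trdeg_add_eq ℂ (MvPolynomial σ ℂ) (A := A)
      rw [MvPolynomial.trdeg_of_isDomain, Cardinal.lift_id] at h
      have hlt := Cardinal.lt_aleph0_of_finite σ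
      have h' : Algebra.trdeg (MvPolynomial σ ℂ) A + Cardinal.mk σ ≤ 0 + Cardinal.mk σ := by
        rw [add_comm, h, zero_add]; exact htr
      exact le_antisymm ((Cardinal.add_le_add_iff_of_lt_aleph0 hlt).1 h') zero_le
    obtain ⟨p, hp, k, H⟩ := exists_ne_zero_forall_fiber (B := MvPolynomial σ ℂ) (A := A) ℂ
    refine ⟨p, hp, k, fun c hc => ?_⟩
    obtain ⟨hfin, hcard, htan⟩ := H (eval c) hc
    have hinj : Function.Injective (fun ψ : A →ₐ[ℂ] ℂ => (ψ : A →+* ℂ)) :=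
      AlgHom.coe_ringHom_injective
    have himage : (fun ψ : A →ₐ[ℂ] ℂ => (ψ : A →+* ℂ)) '' {ψ | ∀ s, ψ (f (X s)) = c s} =
        {ψ : A →+* ℂ | ψ.comp (algebraMap (MvPolynomial σ ℂ) A) = eval c} := by
      ext ψ
      constructor
      · rintro ⟨χ, hχ, rfl⟩
        exact RingHom.ext fun p => hcomp hχ p
      · intro hψ
        refine ⟨{ ψ with commutes' := fun r => ?_ }, fun s => ?_, rfl⟩
        · have := RingHom.congr_fun hψ (C r)
          rw [eval_C, RingHom.comp_apply, hmap, ← algebraMap_eq, f.commutes] at this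
          exact this
        · have := RingHom.congr_fun hψ (X s)
          rw [eval_X] at this
          exact this
    refine ⟨?_, ?_, ?_⟩
    · exact Set.Finite.of_finite_image (himage ▸ hfin) hinj.injOn
    · rw [← hcard, ← himage, Set.ncard_image_of_injective _ hinj]
    · intro ψ hψ d hmul hX
      have hd1 : d 1 = 0 := by simpa using hmul 1 1
      refine LinearMap.ext fun g => htan ψ (RingHom.ext fun p => hcomp hψ p) d d.map_add hmul ?_ g
      intro p
      rw [hmap]
      induction p using MvPolynomial.induction_on with
      | C r => rw [← algebraMap_eq, f.commutes, Algebra.algebraMap_eq_smul_one, map_smul, hd1,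
          smul_zero]
      | add p q hp hq => rw [map_add, map_add, hp, hq, add_zero]
      | mul_X p s hp => rw [map_mul, hmul, hp, hX, mul_zero, mul_zero, add_zero]
  · rw [injective_iff_map_eq_zero] at hf
    push Not at hf
    obtain ⟨p, hfp, hp⟩ := hf
    refine ⟨p, hp, 0, fun c hc => ?_⟩
    have hno : ∀ ψ : A →ₐ[ℂ] ℂ, ¬ ∀ s, ψ (f (X s)) = c s := fun ψ hψ =>
      hc (by rw [← hcomp hψ, hfp, map_zero])
    have hempty : {ψ : A →ₐ[ℂ] ℂ | ∀ s, ψ (f (X s)) = c s} = ∅ :=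
      Set.eq_empty_of_forall_notMem hno
    rw [hempty]
    exact ⟨Set.finite_empty, Set.ncard_empty _, fun ψ hψ => absurd hψ (hno ψ)⟩
end

section
open MvPolynomial

variable {τ : Type} (D : MvPolynomial τ ℂ)

/-- Evaluation of elements of `ℂ[τ][1/D]` at a point outside the zero set of `D`. -/
def evalAway (z : τ → ℂ) (hz : eval z D ≠ 0) : Localization.Away D →ₐ[ℂ] ℂ :=
  IsLocalization.liftAlgHom (M := Submonoid.powers D) (f := aeval z) <| by
    rintro ⟨_, n, rfl⟩
    simpa [aeval_eq_eval] using fun h => absurd h hz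

@[simp]
theorem evalAway_algebraMap (z : τ → ℂ) (hz : eval z D ≠ 0) (r : MvPolynomial τ ℂ) :
    evalAway D z hz (algebraMap _ _ r) = eval z r := by
  rw [evalAway, IsLocalization.liftAlgHom_apply]
  simp

open Classical in
/-- The regular function on the complement of the zero set of `D` defined by `g ∈ ℂ[τ][1/D]`,
extended by zero. -/
def awayValue (g : Localization.Away D) (z : τ → ℂ) : ℂ :=
  if hz : eval z D ≠ 0 then evalAway D z hz g else 0

variable {D}

theorem awayValue_of_ne_zero (g : Localization.Away D) {z : τ → ℂ} (hz : eval z D ≠ 0) :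
    awayValue D g z = evalAway D z hz g := dif_pos hz

variable (D) in
theorem continuous_eval_line (z w : τ → ℂ) : Continuous fun t : ℂ => eval (z + t • w) D := by
  have : Continuous fun t : ℂ => z + t • w := by fun_prop
  exact (MvPolynomial.continuous_eval D).comp this

theorem differentiable_eval_line (r : MvPolynomial τ ℂ) (z w : τ → ℂ) :
    Differentiable ℂ fun t : ℂ => eval (z + t • w) r := by
  intro t
  have : AnalyticAt ℂ (fun t : ℂ => aeval (z + t • w) r) t :=
    AnalyticAt.aeval_mvPolynomial (f := fun t : ℂ => z + t • w)
      (fun i => by simp only [Pi.add_apply, Pi.smul_apply, smul_eq_mul]; fun_prop) r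
  exact this.differentiableAt

theorem eventually_eval_line_ne_zero {z : τ → ℂ} (hz : eval z D ≠ 0) (w : τ → ℂ) :
    ∀ᶠ t : ℂ in nhds 0, eval (z + t • w) D ≠ 0 :=
  (continuous_eval_line D z w).continuousAt.eventually_ne (by simpa using hz)

theorem differentiableAt_awayValue_line (g : Localization.Away D) {z : τ → ℂ}
    (hz : eval z D ≠ 0) (w : τ → ℂ) :
    DifferentiableAt ℂ (fun t : ℂ => awayValue D g (z + t • w)) 0 := by
  obtain ⟨n, r, hr⟩ := IsLocalization.Away.surj D g
  have h : (fun t : ℂ => awayValue D g (z + t • w)) =ᶠ[nhds 0]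
      fun t => eval (z + t • w) r / eval (z + t • w) D ^ n := by
    filter_upwards [eventually_eval_line_ne_zero hz w] with t ht
    have := congrArg (evalAway D _ ht) hr
    rw [map_mul, map_pow, evalAway_algebraMap, evalAway_algebraMap] at this
    rw [awayValue_of_ne_zero g ht, eq_div_iff (pow_ne_zero n ht), this]
  refine DifferentiableAt.congr_of_eventuallyEq ?_ h
  exact (differentiable_eval_line r z w 0).div ((differentiable_eval_line D z w 0).pow n)
    (pow_ne_zero n (by simpa using hz))

/-- The derivation of `ℂ[τ][1/D]` at the point `z` in the direction `w`. -/
def dirDeriv {z : τ → ℂ} (hz : eval z D ≠ 0) (w : τ → ℂ) : Localization.Away D →ₗ[ℂ] ℂ where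
  toFun g := deriv (fun t : ℂ => awayValue D g (z + t • w)) 0
  map_add' g h := by
    rw [← deriv_fun_add (differentiableAt_awayValue_line g hz w)
      (differentiableAt_awayValue_line h hz w)]
    refine Filter.EventuallyEq.deriv_eq ?_
    filter_upwards [eventually_eval_line_ne_zero hz w] with t ht
    simp only [awayValue_of_ne_zero _ ht, map_add]
  map_smul' c g := by
    rw [RingHom.id_apply, smul_eq_mul, ← deriv_const_mul _ (differentiableAt_awayValue_line g hz w)]
    refine Filter.EventuallyEq.deriv_eq ?_
    filter_upwards [eventually_eval_line_ne_zero hz w] with t ht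
    simp only [awayValue_of_ne_zero _ ht, map_smul, smul_eq_mul]

theorem dirDeriv_apply {z : τ → ℂ} (hz : eval z D ≠ 0) (w : τ → ℂ) (g : Localization.Away D) :
    dirDeriv hz w g = deriv (fun t : ℂ => awayValue D g (z + t • w)) 0 := rfl

theorem dirDeriv_mul {z : τ → ℂ} (hz : eval z D ≠ 0) (w : τ → ℂ) (g h : Localization.Away D) :
    dirDeriv hz w (g * h) =
      evalAway D z hz g * dirDeriv hz w h + evalAway D z hz h * dirDeriv hz w g := by
  have hmul := deriv_fun_mul (differentiableAt_awayValue_line g hz w)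
      (differentiableAt_awayValue_line h hz w)
  simp only [zero_smul, add_zero, awayValue_of_ne_zero _ hz] at hmul
  rw [dirDeriv_apply, dirDeriv_apply, dirDeriv_apply]
  trans deriv (fun t : ℂ => awayValue D g (z + t • w) * awayValue D h (z + t • w)) 0
  · refine Filter.EventuallyEq.deriv_eq ?_
    filter_upwards [eventually_eval_line_ne_zero hz w] with t ht
    simp only [awayValue_of_ne_zero _ ht, map_mul]
  · rw [hmul]
    ring

theorem dirDeriv_X {z : τ → ℂ} (hz : eval z D ≠ 0) (w : τ → ℂ) (j : τ) :
    dirDeriv hz w (algebraMap (MvPolynomial τ ℂ) _ (X j)) = w j := by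
  rw [dirDeriv_apply]
  trans deriv (fun t : ℂ => z j + t * w j) 0
  · refine Filter.EventuallyEq.deriv_eq ?_
    filter_upwards [eventually_eval_line_ne_zero hz w] with t ht
    simp [awayValue_of_ne_zero _ ht]
  · simp

/-- For a map from the complement of the hypersurface `D = 0` in `ℂ^τ` to `ℂ^σ` given by regular
functions, with `|τ| ≤ |σ|`, the number of points of a generic fibre is finite and constant, and
the differential is injective along a generic fibre. -/
theorem exists_generic_fiber_away {σ : Type} [Fintype σ] [Fintype τ]
    (hcard : Fintype.card τ ≤ Fintype.card σ) (hD : D ≠ 0) (G : σ → Localization.Away D) :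
    ∃ p : MvPolynomial σ ℂ, p ≠ 0 ∧ ∃ k : ℕ, ∀ c : σ → ℂ, eval c p ≠ 0 →
      {z : τ → ℂ | eval z D ≠ 0 ∧ ∀ s, awayValue D (G s) z = c s}.Finite ∧
      {z : τ → ℂ | eval z D ≠ 0 ∧ ∀ s, awayValue D (G s) z = c s}.ncard = k ∧
      ∀ z : τ → ℂ, eval z D ≠ 0 → (∀ s, awayValue D (G s) z = c s) → ∀ w : τ → ℂ,
        (∀ s, deriv (fun t : ℂ => awayValue D (G s) (z + t • w)) 0 = 0) → w = 0 := by
  have hle := powers_le_nonZeroDivisors_of_noZeroDivisors hD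
  have : IsDomain (Localization.Away D) := IsLocalization.isDomain_localization hle
  have : Algebra.IsAlgebraic (MvPolynomial τ ℂ) (Localization.Away D) :=
    IsLocalization.isAlgebraic _ (Submonoid.powers D)
  have : FaithfulSMul (MvPolynomial τ ℂ) (Localization.Away D) :=
    (faithfulSMul_iff_algebraMap_injective _ _).2 (IsLocalization.injective _ hle)
  have : Algebra.FiniteType ℂ (Localization.Away D) :=
    .trans (S := MvPolynomial τ ℂ) inferInstance inferInstance
  have htr : Algebra.trdeg ℂ (Localization.Away D) ≤ Cardinal.mk σ := by
    rw [← trdeg_add_eq ℂ (MvPolynomial τ ℂ) (A := Localization.Away D),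
      trdeg_eq_zero (R := MvPolynomial τ ℂ), add_zero,
      MvPolynomial.trdeg_of_isDomain, Cardinal.lift_id, Cardinal.mk_fintype, Cardinal.mk_fintype]
    exact_mod_cast hcard
  obtain ⟨p, hp, k, H⟩ := exists_generic_fiber_of_trdeg_le htr (aeval G)
  simp only [aeval_X] at H
  refine ⟨p, hp, k, fun c hc => ?_⟩
  obtain ⟨hfin, hncard, htan⟩ := H c hc
  let pt : (Localization.Away D →ₐ[ℂ] ℂ) → τ → ℂ := fun ψ j =>
    ψ (algebraMap (MvPolynomial τ ℂ) _ (X j))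
  have hpt : ∀ ψ r, ψ (algebraMap (MvPolynomial τ ℂ) _ r) = eval (pt ψ) r := by
    intro ψ r
    have : ψ.comp (Algebra.algHom ℂ (MvPolynomial τ ℂ) (Localization.Away D)) = aeval (pt ψ) :=
      MvPolynomial.algHom_ext fun j => by rw [aeval_X]; rfl
    exact AlgHom.congr_fun this r
  have hinj : Function.Injective pt := fun ψ χ h =>
    IsLocalization.algHom_ext (Submonoid.powers D) <| AlgHom.ext fun r => by
      change ψ (algebraMap (MvPolynomial τ ℂ) _ r) = χ (algebraMap (MvPolynomial τ ℂ) _ r)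
      rw [hpt, hpt, h]
  have hptD : ∀ ψ, eval (pt ψ) D ≠ 0 := fun ψ => by
    rw [← hpt]
    exact ((IsLocalization.Away.algebraMap_isUnit D).map ψ).ne_zero
  have heval : ∀ ψ, evalAway D (pt ψ) (hptD ψ) = ψ := fun ψ => hinj <| funext fun j => by
    simp only [pt]
    rw [evalAway_algebraMap, eval_X]
  have himage : pt '' {ψ | ∀ s, ψ (G s) = c s} =
      {z : τ → ℂ | eval z D ≠ 0 ∧ ∀ s, awayValue D (G s) z = c s} := by
    ext z
    constructor
    · rintro ⟨ψ, hψ, rfl⟩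
      exact ⟨hptD ψ, fun s => by rw [awayValue_of_ne_zero _ (hptD ψ), heval]; exact hψ s⟩
    · rintro ⟨hz, h⟩
      refine ⟨evalAway D z hz, fun s => ?_, funext fun j => ?_⟩
      · rw [← awayValue_of_ne_zero, h]
      · simp [pt]
  rw [← himage]
  refine ⟨hfin.image _, by rw [Set.ncard_image_of_injective _ hinj, hncard], ?_⟩
  intro z hz h w hw
  have hd := htan (evalAway D z hz) (fun s => by rw [← awayValue_of_ne_zero, h]) (dirDeriv hz w)
    (dirDeriv_mul hz w) hw
  funext j
  rw [← dirDeriv_X hz w j, hd]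
  rfl
end

section Kuramoto
open MvPolynomial

/-- The extension of a tuple indexed by the oscillators `1, …, N-1` of the cycle `C_N` to all
natural numbers, with value `1` at the reference oscillator and indices taken modulo `N`. -/
def cyclicExtend {S : Type} [One S] (N : ℕ) (hN : 0 < N) (x : Fin (N - 1) → S) : ℕ → S := fun j =>
  if hr : j % N = 0 then 1
  else x ⟨j % N - 1, Nat.sub_lt_sub_right (Nat.pos_of_ne_zero hr) (Nat.mod_lt j hN)⟩

theorem map_cyclicExtend {S : Type} [CommRing S] (φ : S →+* ℂ) (N : ℕ) (hN : 0 < N)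
    (x : Fin (N - 1) → S) (m : ℕ) :
    φ (cyclicExtend N hN x m) = kuraX N hN (fun j => φ (x j)) m := by
  unfold cyclicExtend kuraX
  split <;> simp

theorem kuraX_inv (N : ℕ) (hN : 0 < N) (x : Fin (N - 1) → ℂ) (m : ℕ) :
    kuraX N hN (fun j => (x j)⁻¹) m = (kuraX N hN x m)⁻¹ := by
  unfold kuraX
  split <;> simp

theorem kuraX_ne_zero (N : ℕ) (hN : 0 < N) {x : Fin (N - 1) → ℂ} (hx : ∀ j, x j ≠ 0) (m : ℕ) :
    kuraX N hN x m ≠ 0 := by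
  unfold kuraX
  split
  · exact one_ne_zero
  · exact hx _

theorem differentiable_kuraX (N : ℕ) (hN : 0 < N) (m : ℕ) :
    Differentiable ℂ fun x => kuraX N hN x m := by
  unfold kuraX
  by_cases hr : m % N = 0
  · simp [hr]
  · simp only [hr, dite_false]
    fun_prop

theorem differentiableAt_kuraF (N : ℕ) (hN : 0 < N) (ω : Fin (N - 1) → ℂ) (a : ℂ)
    (i : Fin (N - 1)) {x : Fin (N - 1) → ℂ} (hx : ∀ j, x j ≠ 0) :
    DifferentiableAt ℂ (kuraF N hN ω a i) x := by
  have h := kuraX_ne_zero N hN hx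
  have hd : ∀ m, DifferentiableAt ℂ (fun x => kuraX N hN x m) x := fun m =>
    (differentiable_kuraX N hN m) x
  have hq : ∀ m l, DifferentiableAt ℂ (fun x => kuraX N hN x m / kuraX N hN x l) x := fun m l => by
    simpa only [div_eq_mul_inv] using (hd m).fun_mul ((hd l).fun_inv (h l))
  exact (((((hq _ _).fun_sub (hq _ _)).fun_add (hq _ _)).fun_sub (hq _ _)).const_mul a).const_sub _

/-- The Jacobian matrix of the Kuramoto system computes directional derivatives. -/
theorem deriv_kuraF_line (N : ℕ) (hN : 0 < N) (ω : Fin (N - 1) → ℂ) (a : ℂ)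
    (i : Fin (N - 1)) {x : Fin (N - 1) → ℂ} (hx : ∀ j, x j ≠ 0) (v : Fin (N - 1) → ℂ) :
    deriv (fun t : ℂ => kuraF N hN ω a i (x + t • v)) 0 = (kuraJac N hN ω a x).mulVec v i := by
  have hf := (differentiableAt_kuraF N hN ω a i hx).hasFDerivAt
  have hline : HasDerivAt (fun t : ℂ => x + t • v) v 0 := by
    simpa using ((hasDerivAt_id (0 : ℂ)).smul_const v).const_add x
  have hentry : ∀ j, kuraJac N hN ω a x i j =
      fderiv ℂ (kuraF N hN ω a i) x (Pi.single j 1) := by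
    intro j
    refine (HasFDerivAt.comp_hasDerivAt (l := kuraF N hN ω a i) (x j) ?_
      (hasDerivAt_update x j (x j))).deriv
    rwa [Function.update_eq_self]
  have hv : v = ∑ j, v j • (Pi.single j 1 : Fin (N - 1) → ℂ) := by
    simpa using (pi_eq_sum_univ' v)
  have hcomp := HasFDerivAt.comp_hasDerivAt (0 : ℂ) (l := kuraF N hN ω a i)
    (by simpa using hf) hline
  rw [show (fun t : ℂ => kuraF N hN ω a i (x + t • v)) =
    kuraF N hN ω a i ∘ fun t : ℂ => x + t • v from rfl, hcomp.deriv]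
  conv_lhs => rw [hv]
  simp only [map_sum, map_smul, smul_eq_mul, Matrix.mulVec, dotProduct, hentry, mul_comm]

/-- The product of the torus coordinates, as a polynomial in the phases and the coupling. -/
def torusProd (N : ℕ) : MvPolynomial (Fin (N - 1) ⊕ Unit) ℂ := ∏ j : Fin (N - 1), X (Sum.inl j)

theorem torusProd_ne_zero (N : ℕ) : torusProd N ≠ 0 :=
  Finset.prod_ne_zero_iff.2 fun _ _ => X_ne_zero _

theorem eval_torusProd_ne_zero {N : ℕ} {z : Fin (N - 1) ⊕ Unit → ℂ} :
    eval z (torusProd N) ≠ 0 ↔ ∀ j, z (Sum.inl j) ≠ 0 := by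
  simp [torusProd, map_prod, Finset.prod_ne_zero_iff]

/-- The map `(x, a) ↦ (ω, a)` whose fibres are the solution sets of the Kuramoto systems consists
of regular functions. -/
theorem exists_kuramoto_map (N : ℕ) (hN : 0 < N) :
    ∃ G : Fin (N - 1) ⊕ Unit → Localization.Away (torusProd N),
      ∀ z : Fin (N - 1) ⊕ Unit → ℂ, eval z (torusProd N) ≠ 0 →
        awayValue (torusProd N) (G (Sum.inr ())) z = z (Sum.inr ()) ∧
        ∀ (ω : Fin (N - 1) → ℂ) (i : Fin (N - 1)), awayValue (torusProd N) (G (Sum.inl i)) z =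
          ω i - kuraF N hN ω (z (Sum.inr ())) i fun j => z (Sum.inl j) := by
  let ι := algebraMap (MvPolynomial (Fin (N - 1) ⊕ Unit) ℂ) (Localization.Away (torusProd N))
  have hunit : ∀ j, ∃ η, ι (X (Sum.inl j)) * η = 1 := fun j =>
    (isUnit_of_dvd_unit (map_dvd ι (Finset.dvd_prod_of_mem _ (Finset.mem_univ j)))
      (IsLocalization.Away.algebraMap_isUnit (torusProd N))).exists_right_inv
  choose η hη using hunit
  let P := cyclicExtend N hN fun j => ι (X (Sum.inl j))
  let Q := cyclicExtend N hN η
  refine ⟨Sum.elim (fun i => ι (X (Sum.inr ())) * (P (i + 1) * Q i - P i * Q (i + 1)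
    + P (i + 1) * Q (i + 2) - P (i + 2) * Q (i + 1))) fun _ => ι (X (Sum.inr ())), ?_⟩
  intro z hz
  have hι : ∀ r, evalAway (torusProd N) z hz (ι r) = eval z r := evalAway_algebraMap _ z hz
  have hP : ∀ m, evalAway (torusProd N) z hz (P m) = kuraX N hN (fun j => z (Sum.inl j)) m := by
    intro m
    refine (map_cyclicExtend (evalAway (torusProd N) z hz).toRingHom N hN _ m).trans ?_
    simp [hι]
  have hQ : ∀ m, evalAway (torusProd N) z hz (Q m) =
      (kuraX N hN (fun j => z (Sum.inl j)) m)⁻¹ := by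
    intro m
    refine (map_cyclicExtend (evalAway (torusProd N) z hz).toRingHom N hN _ m).trans ?_
    rw [← kuraX_inv]
    congr 1
    funext j
    refine eq_inv_of_mul_eq_one_right ?_
    have := congrArg (evalAway (torusProd N) z hz) (hη j)
    rwa [map_mul, map_one, hι, eval_X] at this
  constructor
  · rw [awayValue_of_ne_zero _ hz, Sum.elim_inr, hι, eval_X]
  · intro ω i
    rw [awayValue_of_ne_zero _ hz]
    simp only [Sum.elim_inl, map_mul, map_add, map_sub, hι, eval_X, hP, hQ, kuraF, div_eq_mul_inv]
    ring

end Kuramoto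

/-- For `N ≥ 3` and `n = N−1`, there are a nonzero polynomial `p` in the `n+1`
variables `(ω_1, …, ω_n, a)` and a natural number `k` such that whenever `p(ω, a) ≠ 0`,
the solution set of the algebraic Kuramoto system for `C_N` with uniform coupling in
`(ℂ∖{0})^n` is finite of cardinality exactly `k`, and at each solution the `n×n` Jacobian
matrix `(∂f_i/∂x_j)` is invertible. -/
theorem kuramoto_cycle_uniform_generic_nonsingular (N : ℕ) (hN : 3 ≤ N) :
    ∃ p : MvPolynomial (Fin (N - 1) ⊕ Unit) ℂ, p ≠ 0 ∧
      ∃ k : ℕ,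
        ∀ (ω : Fin (N - 1) → ℂ) (a : ℂ),
          MvPolynomial.eval (Sum.elim ω fun _ => a) p ≠ 0 →
          ({x : Fin (N - 1) → ℂ | (∀ j, x j ≠ 0) ∧
              ∀ i, kuraF N (by omega) ω a i x = 0} : Set (Fin (N - 1) → ℂ)).Finite ∧
          ({x : Fin (N - 1) → ℂ | (∀ j, x j ≠ 0) ∧
              ∀ i, kuraF N (by omega) ω a i x = 0} : Set (Fin (N - 1) → ℂ)).ncard = k ∧
          ∀ x : Fin (N - 1) → ℂ, (∀ j, x j ≠ 0) → (∀ i, kuraF N (by omega) ω a i x = 0) →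
            IsUnit (kuraJac N (by omega) ω a x) := by
  obtain ⟨G, hG⟩ := exists_kuramoto_map N (by omega)
  obtain ⟨p, hp, k, H⟩ := exists_generic_fiber_away le_rfl (torusProd_ne_zero N) G
  refine ⟨p, hp, k, fun ω a hc => ?_⟩
  obtain ⟨hfin, hcard, htan⟩ := H _ hc
  let emb : (Fin (N - 1) → ℂ) → Fin (N - 1) ⊕ Unit → ℂ := fun x => Sum.elim x fun _ => a
  have hemb : Function.Injective emb := fun x y h => funext fun j => congrFun h (Sum.inl j)
  have hD : ∀ {x : Fin (N - 1) → ℂ}, (∀ j, x j ≠ 0) →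
      MvPolynomial.eval (emb x) (torusProd N) ≠ 0 :=
    fun hx => eval_torusProd_ne_zero.2 hx
  have hsol : ∀ {x : Fin (N - 1) → ℂ}, (∀ j, x j ≠ 0) → (∀ i, kuraF N (by omega) ω a i x = 0) →
      ∀ s, awayValue (torusProd N) (G s) (emb x) = Sum.elim ω (fun _ => a) s := by
    rintro x hx h (i | _)
    · rw [((hG _ (hD hx)).2 ω i)]
      exact (congrArg (ω i - ·) (h i)).trans (sub_zero _)
    · exact (hG _ (hD hx)).1
  have himage : emb '' {x | (∀ j, x j ≠ 0) ∧ ∀ i, kuraF N (by omega) ω a i x = 0} =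
      {z | MvPolynomial.eval z (torusProd N) ≠ 0 ∧
        ∀ s, awayValue (torusProd N) (G s) z = Sum.elim ω (fun _ => a) s} := by
    ext z
    constructor
    · rintro ⟨x, ⟨hx, h⟩, rfl⟩
      exact ⟨hD hx, hsol hx h⟩
    · rintro ⟨hz, h⟩
      have ha : z (Sum.inr ()) = a := (hG z hz).1.symm.trans (h _)
      refine ⟨fun j => z (Sum.inl j), ⟨eval_torusProd_ne_zero.1 hz, fun i => ?_⟩, ?_⟩
      · have := ((hG z hz).2 ω i).symm.trans (h (Sum.inl i))
        rwa [ha, Sum.elim_inl, sub_eq_self] at this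
      · funext s
        rcases s with j | _
        · rfl
        · exact ha.symm
  rw [← himage] at hfin hcard
  refine ⟨hfin.of_finite_image hemb.injOn, by rwa [Set.ncard_image_of_injective _ hemb] at hcard,
    fun x hx h => ?_⟩
  refine Matrix.mulVec_injective_iff_isUnit.1 <| (injective_iff_map_eq_zero
    (kuraJac N (by omega) ω a x).mulVecLin).2 fun v hv => ?_
  have hline : ∀ t : ℂ, emb x + t • (Sum.elim v fun _ => 0) = emb (x + t • v) := by
    intro t
    funext s
    rcases s with j | _ <;> simp [emb]
  have hw : (Sum.elim v fun _ => 0 : Fin (N - 1) ⊕ Unit → ℂ) = 0 := by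
    refine htan (emb x) (hD hx) (hsol hx h) _ ?_
    have hev := eventually_eval_line_ne_zero (hD hx) (Sum.elim v fun _ => 0)
    rintro (i | _)
    · trans deriv (fun t : ℂ => ω i - kuraF N (by omega) ω a i (x + t • v)) 0
      · refine Filter.EventuallyEq.deriv_eq ?_
        filter_upwards [hev] with t ht
        rw [(hG _ ht).2 ω i, hline]
        rfl
      · rw [deriv_const_sub, deriv_kuraF_line N _ ω a i hx v, neg_eq_zero]
        exact congrFun hv i
    · trans deriv (fun _ : ℂ => a) 0
      · refine Filter.EventuallyEq.deriv_eq ?_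
        filter_upwards [hev] with t ht
        rw [(hG _ ht).1, hline]
        rfl
      · exact deriv_const _ _
  exact funext fun j => congrFun hw (Sum.inl j)
end
end
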